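/- arXiv:1509.07808 — 9 statements merged into one kernel-verified Lean document; each statement's English description precedes it below -/
import Mathlib

section
/- Let K = {x ∈ ℝ^N : Ax ≥ b}, let r ≥ 1, let y ∈ Las_r(K), and let i ∈ [N] be a variable with 0 < y_{{i}} < 1. Define z^{(1)}_I := y_{I∪{i}}/y_{{i}} and z^{(0)}_I := (y_I − y_{I∪{i}})/(1 − y_{{i}}) for all subsets I. Then y_I = y_{{i}}·z^{(1)}_I + (1 − y_{{i}})·z^{(0)}_I for all I, both z^{(0)} and z^{(1)} belong to Las_{r−1}(K), and z^{(0)}_{{i}} = 0 while z^{(1)}_{{i}} = 1. -/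
open scoped Classical

noncomputable section

namespace SchedLP

/-- Moment matrix `M_r(y) = (y_{S₁ ∪ S₂})_{|S₁|,|S₂| ≤ r}`. -/
def momentMatrix {ι : Type} [Fintype ι] (r : ℕ) (y : Finset ι → ℝ) :
    Matrix {S : Finset ι // S.card ≤ r} {S : Finset ι // S.card ≤ r} ℝ :=
  fun S₁ S₂ => y (S₁.1 ∪ S₂.1)

/-- Slack moment matrix of the `ℓ`-th linear constraint of `A x ≥ b`. -/
def slackMatrix {ι κ : Type} [Fintype ι] (A : κ → ι → ℝ) (b : κ → ℝ) (r : ℕ)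
    (y : Finset ι → ℝ) (ℓ : κ) :
    Matrix {S : Finset ι // S.card ≤ r} {S : Finset ι // S.card ≤ r} ℝ :=
  fun S₁ S₂ => ∑ i, A ℓ i * y (insert i (S₁.1 ∪ S₂.1)) - b ℓ * y (S₁.1 ∪ S₂.1)

/-- `y` lies in the level-`r` Lasserre lift of the polyhedron `{x : A x ≥ b}`. -/
def InLasserre {ι κ : Type} [Fintype ι] (A : κ → ι → ℝ) (b : κ → ℝ) (r : ℕ)
    (y : Finset ι → ℝ) : Prop :=
  y ∅ = 1 ∧ (momentMatrix r y).PosSemidef ∧ ∀ ℓ, (slackMatrix A b r y ℓ).PosSemidef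

/-- The polyhedron `K = {x : A x ≥ b}`. -/
def KPoly {ι κ : Type} [Fintype ι] (A : κ → ι → ℝ) (b : κ → ℝ) : Set (ι → ℝ) :=
  {x | ∀ ℓ, b ℓ ≤ ∑ i, A ℓ i * x i}

/-- Shifting by `i` preserves positive semidefiniteness of moment matrices, at the cost of a
level. -/
theorem momentMatrix_insert_posSemidef {ι : Type} [Fintype ι] {r : ℕ} (i : ι)
    {f : Finset ι → ℝ} (hf : (momentMatrix (r + 1) f).PosSemidef) :
    (momentMatrix r fun I => f (insert i I)).PosSemidef := by
  let ins : {S : Finset ι // S.card ≤ r} → {S : Finset ι // S.card ≤ r + 1} :=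
    fun S => ⟨insert i S.1, (Finset.card_insert_le _ _).trans (Nat.succ_le_succ S.2)⟩
  convert hf.submatrix ins using 1
  ext S T
  simp only [momentMatrix, Matrix.submatrix_apply, ins]
  rw [← Finset.insert_union_distrib]

/-- The complementary shift `f_I - f_{I ∪ {i}}` preserves positive semidefiniteness of moment
matrices, at the cost of a level. -/
theorem momentMatrix_sub_insert_posSemidef {ι : Type} [Fintype ι] {r : ℕ} (i : ι)
    {f : Finset ι → ℝ} (hf : (momentMatrix (r + 1) f).PosSemidef) :
    (momentMatrix r fun I => f I - f (insert i I)).PosSemidef := by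
  let inc : {S : Finset ι // S.card ≤ r} → {S : Finset ι // S.card ≤ r + 1} :=
    fun S => ⟨S.1, S.2.trans (Nat.le_succ r)⟩
  let ins : {S : Finset ι // S.card ≤ r} → {S : Finset ι // S.card ≤ r + 1} :=
    fun S => ⟨insert i S.1, (Finset.card_insert_le _ _).trans (Nat.succ_le_succ S.2)⟩
  let B : Matrix {S : Finset ι // S.card ≤ r + 1} {S : Finset ι // S.card ≤ r} ℝ :=
    .of fun S T => (if S = inc T then 1 else 0) - (if S = ins T then 1 else 0)
  convert hf.conjTranspose_mul_mul_same B using 1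
  ext S T
  have h₁ : (S.1 ∪ insert i T.1) = insert i (S.1 ∪ T.1) := Finset.union_insert _ _ _
  have h₂ : (insert i S.1 ∪ T.1) = insert i (S.1 ∪ T.1) := Finset.insert_union _ _ _
  have h₃ : (insert i S.1 ∪ insert i T.1) = insert i (S.1 ∪ T.1) :=
    (Finset.insert_union_distrib _ _ _).symm
  simp only [momentMatrix, Matrix.mul_apply, Matrix.conjTranspose_apply, Matrix.of_apply, B,
    star_trivial, mul_sub, sub_mul, Finset.sum_sub_distrib, mul_ite, ite_mul, mul_one, one_mul, mul_zero,
    zero_mul, Finset.sum_ite_eq', Finset.mem_univ, if_true, inc, ins, h₁, h₂, h₃]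
  ring

theorem momentMatrix_smul {ι : Type} [Fintype ι] (r : ℕ) (c : ℝ) (f : Finset ι → ℝ) :
    momentMatrix r (c • f) = c • momentMatrix r f := rfl

theorem slackMatrix_eq_momentMatrix {ι κ : Type} [Fintype ι] (A : κ → ι → ℝ) (b : κ → ℝ)
    (r : ℕ) (y : Finset ι → ℝ) (ℓ : κ) :
    slackMatrix A b r y ℓ =
      momentMatrix r fun I => ∑ j, A ℓ j * y (insert j I) - b ℓ * y I := rfl

/-- Conditioning on the event `x_i = 1`. -/
theorem InLasserre.condition_one {ι κ : Type} [Fintype ι] {A : κ → ι → ℝ} {b : κ → ℝ} {r : ℕ}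
    {y : Finset ι → ℝ} (hy : InLasserre A b (r + 1) y) {i : ι} (hi : 0 < y {i}) :
    InLasserre A b r ((y {i})⁻¹ • fun I => y (insert i I)) := by
  have hc : 0 ≤ (y {i})⁻¹ := inv_nonneg.2 hi.le
  refine ⟨?_, ?_, fun ℓ => ?_⟩
  · simp [hi.ne']
  · rw [momentMatrix_smul]
    exact (momentMatrix_insert_posSemidef i hy.2.1).smul hc
  · have hℓ := hy.2.2 ℓ
    rw [slackMatrix_eq_momentMatrix] at hℓ ⊢
    convert (momentMatrix_insert_posSemidef i hℓ).smul hc using 1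
    rw [← momentMatrix_smul]
    congr 1
    ext I
    simp only [Pi.smul_apply, smul_eq_mul, mul_sub, Finset.mul_sum, Finset.insert_comm i]
    congr 1
    · exact Finset.sum_congr rfl fun j _ => by ring
    · ring

/-- Conditioning on the event `x_i = 0`. -/
theorem InLasserre.condition_zero {ι κ : Type} [Fintype ι] {A : κ → ι → ℝ} {b : κ → ℝ} {r : ℕ}
    {y : Finset ι → ℝ} (hy : InLasserre A b (r + 1) y) {i : ι} (hi : y {i} < 1) :
    InLasserre A b r ((1 - y {i})⁻¹ • fun I => y I - y (insert i I)) := by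
  have hpos : 0 < 1 - y {i} := sub_pos.2 hi
  have hc : 0 ≤ (1 - y {i})⁻¹ := inv_nonneg.2 hpos.le
  refine ⟨?_, ?_, fun ℓ => ?_⟩
  · simp [hy.1, hpos.ne']
  · rw [momentMatrix_smul]
    exact (momentMatrix_sub_insert_posSemidef i hy.2.1).smul hc
  · have hℓ := hy.2.2 ℓ
    rw [slackMatrix_eq_momentMatrix] at hℓ ⊢
    convert (momentMatrix_sub_insert_posSemidef i hℓ).smul hc using 1
    rw [← momentMatrix_smul]
    congr 1
    ext I
    simp only [Pi.smul_apply, smul_eq_mul, Finset.insert_comm i, mul_left_comm _ (1 - y {i})⁻¹,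
      ← Finset.mul_sum, mul_sub, Finset.sum_sub_distrib]
    ring

/-- Conditioning: if `y ∈ Las_r(K)` with `r ≥ 1` and `0 < y_{i} < 1`, then with
`z¹_I = y_{I∪{i}}/y_{i}` and `z⁰_I = (y_I − y_{I∪{i}})/(1 − y_{i})` one has
`y = y_{i}·z¹ + (1−y_{i})·z⁰`, both `z⁰, z¹ ∈ Las_{r−1}(K)`, `z⁰_{i} = 0` and `z¹_{i} = 1`. -/
theorem statement3 {N M : ℕ} (A : Fin M → Fin N → ℝ) (b : Fin M → ℝ) (r : ℕ)
    (hr : 1 ≤ r) (y : Finset (Fin N) → ℝ) (hy : InLasserre A b r y) (i : Fin N)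
    (h0 : 0 < y {i}) (h1 : y {i} < 1)
    (z1 z0 : Finset (Fin N) → ℝ)
    (hz1 : ∀ I : Finset (Fin N), z1 I = y (insert i I) / y {i})
    (hz0 : ∀ I : Finset (Fin N), z0 I = (y I - y (insert i I)) / (1 - y {i})) :
    (∀ I : Finset (Fin N), y I = y {i} * z1 I + (1 - y {i}) * z0 I) ∧
    InLasserre A b (r - 1) z0 ∧ InLasserre A b (r - 1) z1 ∧
    z0 {i} = 0 ∧ z1 {i} = 1 := by
  have hpos : 0 < 1 - y {i} := sub_pos.2 h1
  obtain ⟨r, rfl⟩ := Nat.exists_eq_add_of_le' hr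
  refine ⟨fun I => ?_, ?_, ?_, ?_, ?_⟩
  · rw [hz1, hz0, mul_div_cancel₀ _ h0.ne', mul_div_cancel₀ _ hpos.ne']
    ring
  · rw [Nat.add_sub_cancel]
    convert hy.condition_zero h1 using 1
    ext I
    rw [hz0, Pi.smul_apply, smul_eq_mul, div_eq_inv_mul]
    congr!
  · rw [Nat.add_sub_cancel]
    convert hy.condition_one h0 using 1
    ext I
    rw [hz1, Pi.smul_apply, smul_eq_mul, div_eq_inv_mul]
    congr!
  · simp [hz0]
  · simp [hz1, h0.ne']

end SchedLP

end
end

section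
/- Let J be a finite set of unit-length jobs with a strict partial order ≺, m ≥ 1 the number of identical machines, J_disc ⊆ J, and let σ : J ∖ J_disc → {1,…,T} be a map with |σ^{-1}(t)| ≤ m for all t ∈ {1,…,T} and σ(j) < σ(j') whenever j, j' ∈ J ∖ J_disc and j ≺ j'. Then there exists a map σ* : J → {1,…,T + |J_disc|} with |σ*^{-1}(t)| ≤ m for all t and σ*(j) < σ*(j') whenever j, j' ∈ J and j ≺ j' (i.e., the discarded jobs can be inserted at the cost of increasing the makespan by at most |J_disc|). -/
open scoped Classical

noncomputable section

/-- Any feasible schedule `σ : J ∖ J_disc → {1,…,T}` on `m ≥ 1` machines (unit jobs, strict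
precedence order `prec`, precedence ignored for discarded jobs) can be modified to a feasible
schedule `σ* : J → {1,…,T + |J_disc|}` of all jobs. -/
theorem statement6 (J : Type) [Fintype J] (prec : J → J → Prop)
    (hirr : ∀ j, ¬ prec j j)
    (htrans : ∀ j₁ j₂ j₃, prec j₁ j₂ → prec j₂ j₃ → prec j₁ j₃)
    (m T : ℕ) (hm : 1 ≤ m) (Jdisc : Finset J) (σ : J → ℕ)
    (hrange : ∀ j ∉ Jdisc, 1 ≤ σ j ∧ σ j ≤ T)
    (hcap : ∀ t : ℕ, (Finset.univ.filter (fun j => j ∉ Jdisc ∧ σ j = t)).card ≤ m)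
    (hprec : ∀ j j', j ∉ Jdisc → j' ∉ Jdisc → prec j j' → σ j < σ j') :
    ∃ σs : J → ℕ,
      (∀ j, 1 ≤ σs j ∧ σs j ≤ T + Jdisc.card) ∧
      (∀ t : ℕ, (Finset.univ.filter (fun j => σs j = t)).card ≤ m) ∧
      (∀ j j', prec j j' → σs j < σs j') := by
  induction Jdisc using Finset.induction_on generalizing σ T with
  | empty => exact ⟨σ, by simpa using hrange, by simpa using hcap, by simpa using hprec⟩
  | insert d s hd ih =>
    simp only [Finset.mem_insert, not_or] at hrange hcap hprec
    -- `t₀` is the last slot used by a scheduled predecessor of `d`; `d` gets a new slot after it.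
    obtain ⟨t₀, ht₀T, hpred, hsucc⟩ : ∃ t₀ ≤ T,
        (∀ j, (j ≠ d ∧ j ∉ s) → prec j d → σ j ≤ t₀) ∧
        (∀ j, (j ≠ d ∧ j ∉ s) → prec d j → t₀ < σ j) := by
      refine ⟨(Finset.univ.filter fun j => (j ≠ d ∧ j ∉ s) ∧ prec j d).sup σ, ?_, ?_, ?_⟩
      · refine Finset.sup_le fun j hj => ?_
        exact (hrange j (Finset.mem_filter.1 hj).2.1).2
      · exact fun j hj hjd => Finset.le_sup (f := σ) (by simpa using ⟨hj, hjd⟩)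
      · intro j hj hdj
        refine (Finset.sup_lt_iff (hrange j hj).1).2 fun i hi => ?_
        obtain ⟨hi, hid⟩ := (Finset.mem_filter.1 hi).2
        exact hprec i j hi hj (htrans i d j hid hdj)
    let τ : J → ℕ := fun j => if j = d then t₀ + 1 else if σ j ≤ t₀ then σ j else σ j + 1
    obtain ⟨σs, h₁, h₂, h₃⟩ := ih (T + 1) τ
      (by
        intro j hj
        have := hrange j
        grind)
      (by
        intro t
        rcases lt_trichotomy t (t₀ + 1) with ht | rfl | ht
        · refine (Finset.card_le_card fun j hj => ?_).trans (hcap t)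
          simp only [Finset.mem_filter, Finset.mem_univ, true_and] at hj ⊢
          grind
        · refine (Finset.card_le_card (t := {d}) fun j hj => ?_).trans (by simpa using hm)
          simp only [Finset.mem_filter, Finset.mem_univ, true_and, Finset.mem_singleton] at hj ⊢
          grind
        · refine (Finset.card_le_card fun j hj => ?_).trans (hcap (t - 1))
          simp only [Finset.mem_filter, Finset.mem_univ, true_and] at hj ⊢
          grind)
      (by
        intro j j' hj hj' h
        have := hprec j j'
        have := hpred j
        have := hsucc j'
        have := hirr d
        grind)
    refine ⟨σs, fun j => ?_, h₂, h₃⟩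
    rw [Finset.card_insert_of_notMem hd]
    have := h₁ j
    omega

end
end

section
/- Let T be a power of two, let I* be an interval of the balanced binary laminar family over {1,…,T} with |I*| = T*, let k ≥ 1 with k² ≤ log₂ T*, let δ > 0, and let y* ∈ Las_{r*}(K(T)) with r* ≥ 2mk²·2^{k²}/δ. Then there exists a vector y** ∈ Las_{r**}(K(T)) with r** := r* − ⌈2mk²·2^{k²}/δ⌉, obtained from y* by a sequence of at most 2mk²·2^{k²}/δ successive conditionings on events of the form x_{j,I} = 1 (j a job, I a dyadic interval), such that Δ(J(I,y**)) ≤ δ·|I| for every interval I in the levels 𝓘*_0 ∪ … ∪ 𝓘*_{k²−1} of the dyadic dissection of I*. -/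
open scoped Classical

noncomputable section

namespace SchedLP

/-- Intervals `I ⊆ {1,…,T}`, encoded by their two endpoints (0-based). -/
abbrev Iv (T : ℕ) := {p : Fin T × Fin T // p.1 ≤ p.2}

/-- Membership of a time `t` in an interval `I`. -/
def memIv {T : ℕ} (t : Fin T) (I : Iv T) : Prop := I.1.1 ≤ t ∧ t ≤ I.1.2

/-- Variable index set of the time-indexed LP `K(T)`: variables `x_{j,t}` and `x_{j,I}`. -/
abbrev SchedVar (J : Type) (T : ℕ) := (J × Fin T) ⊕ (J × Iv T)

/-- Constraint index set of the time-indexed LP `K(T)`. -/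
abbrev SchedCon (J : Type) (T : ℕ) :=
  (J ⊕ J) ⊕ (Fin T) ⊕ (J × J × Fin T) ⊕ ((J × Iv T) ⊕ (J × Iv T)) ⊕ ((J × Fin T) ⊕ (J × Fin T))

/-- The coefficient matrix of `K(T)`, with all constraints written in the form `A x ≥ b`.
Rows: `∑_t x_{j,t} ≥ 1`, `-∑_t x_{j,t} ≥ -1`, `-∑_j x_{j,t} ≥ -m`,
`∑_{t'≤t} x_{i,t'} - ∑_{t'≤t+1} x_{j,t'} ≥ 0` for `i ≺ j`,
`x_{j,I} - ∑_{t∈I} x_{j,t} ≥ 0` and its reverse, `x_{j,t} ≥ 0`, `-x_{j,t} ≥ -1`. -/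
def schedA {J : Type} (prec : J → J → Prop) (T : ℕ) :
    SchedCon J T → SchedVar J T → ℝ
  | Sum.inl (Sum.inl j) => fun v =>
      match v with
      | Sum.inl (j', _) => if j' = j then 1 else 0
      | Sum.inr _ => 0
  | Sum.inl (Sum.inr j) => fun v =>
      match v with
      | Sum.inl (j', _) => if j' = j then -1 else 0
      | Sum.inr _ => 0
  | Sum.inr (Sum.inl t) => fun v =>
      match v with
      | Sum.inl (_, t') => if t' = t then -1 else 0
      | Sum.inr _ => 0
  | Sum.inr (Sum.inr (Sum.inl (i, j, t))) => fun v =>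
      if prec i j then
        match v with
        | Sum.inl (j', t') =>
            (if j' = i ∧ t' ≤ t then (1 : ℝ) else 0) +
              (if j' = j ∧ (t' : ℕ) + 1 ≤ (t : ℕ) + 2 then -1 else 0)
        | Sum.inr _ => 0
      else 0
  | Sum.inr (Sum.inr (Sum.inr (Sum.inl (Sum.inl (j, I))))) => fun v =>
      match v with
      | Sum.inl (j', t') => if j' = j ∧ memIv t' I then -1 else 0
      | Sum.inr (j', I') => if j' = j ∧ I' = I then 1 else 0
  | Sum.inr (Sum.inr (Sum.inr (Sum.inl (Sum.inr (j, I))))) => fun v =>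
      match v with
      | Sum.inl (j', t') => if j' = j ∧ memIv t' I then 1 else 0
      | Sum.inr (j', I') => if j' = j ∧ I' = I then -1 else 0
  | Sum.inr (Sum.inr (Sum.inr (Sum.inr (Sum.inl (j, t))))) => fun v =>
      if v = Sum.inl (j, t) then 1 else 0
  | Sum.inr (Sum.inr (Sum.inr (Sum.inr (Sum.inr (j, t))))) => fun v =>
      if v = Sum.inl (j, t) then -1 else 0

/-- The right-hand side of the constraints of `K(T)`. -/
def schedb (J : Type) (m T : ℕ) : SchedCon J T → ℝ
  | Sum.inl (Sum.inl _) => 1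
  | Sum.inl (Sum.inr _) => -1
  | Sum.inr (Sum.inl _) => -(m : ℝ)
  | Sum.inr (Sum.inr (Sum.inl _)) => 0
  | Sum.inr (Sum.inr (Sum.inr (Sum.inl _))) => 0
  | Sum.inr (Sum.inr (Sum.inr (Sum.inr (Sum.inl _)))) => 0
  | Sum.inr (Sum.inr (Sum.inr (Sum.inr (Sum.inr _)))) => -1

/-- `y` lies in the level-`r` Lasserre lift `Las_r(K(T))` of the time-indexed LP. -/
def LasSched (J : Type) [Fintype J] (prec : J → J → Prop) (m T r : ℕ)
    (y : Finset (SchedVar J T) → ℝ) : Prop :=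
  InLasserre (schedA prec T) (schedb J m T) r y

/-- `I` is a member of the balanced binary laminar family over `{1,…,T}` with `T = 2^L`
(endpoints encoded 0-based). -/
def IsDyadicOf (T L : ℕ) (I : Iv T) : Prop :=
  ∃ ℓ i : ℕ, ℓ ≤ L ∧ i < 2 ^ ℓ ∧
    (I.1.1 : ℕ) = i * 2 ^ (L - ℓ) ∧ (I.1.2 : ℕ) + 1 = (i + 1) * 2 ^ (L - ℓ)

/-- `I` is the `i`-th interval of level `ℓ` of the dyadic dissection of `Istar`. -/
def IsSubDyadicOf {T : ℕ} (Istar I : Iv T) (ℓ i : ℕ) : Prop :=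
  i < 2 ^ ℓ ∧ 2 ^ ℓ ∣ ((Istar.1.2 : ℕ) + 1 - (Istar.1.1 : ℕ)) ∧
    (I.1.1 : ℕ) = (Istar.1.1 : ℕ) + i * (((Istar.1.2 : ℕ) + 1 - (Istar.1.1 : ℕ)) / 2 ^ ℓ) ∧
    (I.1.2 : ℕ) + 1 = (Istar.1.1 : ℕ) + (i + 1) * (((Istar.1.2 : ℕ) + 1 - (Istar.1.1 : ℕ)) / 2 ^ ℓ)

/-- `I'` is one of the two halves of the (even-length) interval `I`. -/
def IsHalf {T : ℕ} (I I' : Iv T) : Prop :=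
  ∃ h : ℕ, (I.1.2 : ℕ) + 1 - (I.1.1 : ℕ) = 2 * h ∧
    ((I'.1.1 = I.1.1 ∧ (I'.1.2 : ℕ) + 1 = (I.1.1 : ℕ) + h) ∨
     ((I'.1.1 : ℕ) = (I.1.1 : ℕ) + h ∧ I'.1.2 = I.1.2))

/-- `J(I,y)`: the job `j` is owned by the dyadic interval `I` in the Lasserre vector `y`,
i.e. `y_{j,I} = 1` but `y_{j,I'} < 1` for both halves `I'` of `I`. -/
def OwnedBy {J : Type} {T : ℕ} (y : Finset (SchedVar J T) → ℝ) (I : Iv T) (j : J) : Prop :=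
  y {Sum.inr (j, I)} = 1 ∧ ∀ I' : Iv T, IsHalf I I' → y {Sum.inr (j, I')} < 1

/-- One conditioning step on an event `x_{j,I} = 1` where `I` is a dyadic interval. -/
def CondStepDyadic {J : Type} (T L : ℕ)
    (z z' : Finset (SchedVar J T) → ℝ) : Prop :=
  ∃ (j : J) (I : Iv T), IsDyadicOf T L I ∧ 0 < z {Sum.inr (j, I)} ∧
    ∀ S : Finset (SchedVar J T),
      z' S = z (insert (Sum.inr (j, I)) S) / z {Sum.inr (j, I)}

section Lasserre

variable {ι κ : Type} [Fintype ι] {A : κ → ι → ℝ} {b : κ → ℝ} {y z : Finset ι → ℝ}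

lemma InLasserre.mono {r r' : ℕ} (hrr : r' ≤ r) (hy : InLasserre A b r y) :
    InLasserre A b r' y := by
  obtain ⟨h0, h1, h2⟩ := hy
  let e : {S : Finset ι // S.card ≤ r'} → {S : Finset ι // S.card ≤ r} :=
    fun S => ⟨S.1, S.2.trans hrr⟩
  exact ⟨h0, h1.submatrix e, fun ℓ => (h2 ℓ).submatrix e⟩

lemma InLasserre.singleton_mem_KPoly {r : ℕ} (hy : InLasserre A b r y) :
    (fun v => y {v}) ∈ KPoly A b := by
  intro ℓ
  have h := (hy.2.2 ℓ).diag_nonneg (i := ⟨∅, by simp⟩)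
  simpa [slackMatrix, hy.1] using h

lemma InLasserre.cond [inst : DecidableEq ι] {r : ℕ} (hy : InLasserre A b (r + 1) y) {v : ι}
    (hv : 0 < y {v}) (hz : ∀ S, z S = y (insert v S) / y {v}) : InLasserre A b r z := by
  obtain rfl : inst = Classical.decEq ι := Subsingleton.elim _ _
  obtain ⟨h0, h1, h2⟩ := hy
  let e : {S : Finset ι // S.card ≤ r} → {S : Finset ι // S.card ≤ r + 1} :=
    fun S => ⟨insert v S.1, (Finset.card_insert_le _ _).trans (by have := S.2; omega)⟩
  have hc : (0 : ℝ) ≤ (y {v})⁻¹ := by positivity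
  refine ⟨?_, ?_, fun ℓ => ?_⟩
  · rw [hz]
    exact div_self hv.ne'
  · convert (h1.submatrix e).smul hc using 1
    ext S₁ S₂
    have : insert v (S₁.1 ∪ S₂.1) = insert v S₁.1 ∪ insert v S₂.1 := by
      ext; simp only [Finset.mem_insert, Finset.mem_union]; tauto
    simp only [momentMatrix, hz, Matrix.smul_apply, Matrix.submatrix_apply, e, smul_eq_mul]
    rw [div_eq_inv_mul]
    congr 2
  · convert ((h2 ℓ).submatrix e).smul hc using 1
    ext S₁ S₂
    have key : ∀ i, insert v (insert i (S₁.1 ∪ S₂.1)) =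
        insert i (insert v S₁.1 ∪ insert v S₂.1) := by
      intro i; ext; simp only [Finset.mem_insert, Finset.mem_union]; tauto
    have key' : insert v (S₁.1 ∪ S₂.1) = insert v S₁.1 ∪ insert v S₂.1 := by
      ext; simp only [Finset.mem_insert, Finset.mem_union]; tauto
    simp only [slackMatrix, hz, Matrix.smul_apply, Matrix.submatrix_apply, e, smul_eq_mul]
    rw [mul_sub, Finset.mul_sum]
    congr 1
    · refine Finset.sum_congr rfl fun i _ => ?_
      have : y (insert v (insert i (S₁.1 ∪ S₂.1))) =
          y (insert i (insert v S₁.1 ∪ insert v S₂.1)) := congrArg y (key i)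
      convert congrArg (fun q => A ℓ i * (q / y {v})) this using 1
      ring
    · convert congrArg (fun q => b ℓ * (q / y {v})) (congrArg y key') using 1
      ring

lemma InLasserre.insert_eq_of_eq_one [inst : DecidableEq ι] {r : ℕ}
    (hy : InLasserre A b (r + 1) y) {v w : ι} (hw : y {w} = 1) : y (insert v {w}) = y {v} := by
  obtain rfl : inst = Classical.decEq ι := Subsingleton.elim _ _
  let e : Fin 3 → {S : Finset ι // S.card ≤ r + 1} :=
    ![⟨∅, by simp⟩, ⟨{v}, by simp⟩, ⟨{w}, by simp⟩]
  have h := (hy.2.1.submatrix e).det_nonneg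
  have hwv : ({w} : Finset ι) ∪ {v} = insert v {w} := by rw [Finset.union_comm]; rfl
  rw [Matrix.det_fin_three] at h
  simp [e, momentMatrix, hy.1, hw, hwv] at h
  have h3 : (y {v} - y (insert v {w})) ^ 2 ≤ 0 := by linarith
  nlinarith [sq_nonneg (y {v} - y (insert v {w}))]

lemma InLasserre.cond_eq_one [DecidableEq ι] {r : ℕ} (hy : InLasserre A b (r + 1) y) {v w : ι}
    (hv : 0 < y {v}) (hz : ∀ S, z S = y (insert v S) / y {v}) (hw : y {w} = 1) : z {w} = 1 := by
  rw [hz, hy.insert_eq_of_eq_one hw, div_self hv.ne']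

end Lasserre

section Feasible

variable {J : Type} [Fintype J] {prec : J → J → Prop} {m T : ℕ}

/-- The constraints of `K(T)`, written out. -/
structure LPFeasible (prec : J → J → Prop) (m : ℕ) (x : SchedVar J T → ℝ) : Prop where
  nonneg : ∀ j t, 0 ≤ x (Sum.inl (j, t))
  total : ∀ j, ∑ t, x (Sum.inl (j, t)) = 1
  capacity : ∀ t, ∑ j, x (Sum.inl (j, t)) ≤ m
  precedence : ∀ i j, prec i j → ∀ t : Fin T,
    ∑ t' : Fin T, (if (t' : ℕ) ≤ t + 1 then x (Sum.inl (j, t')) else 0) ≤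
      ∑ t' : Fin T, (if t' ≤ t then x (Sum.inl (i, t')) else 0)
  interval : ∀ j I, x (Sum.inr (j, I)) = ∑ t, if memIv t I then x (Sum.inl (j, t)) else 0

lemma lpFeasible_of_mem_KPoly {x : SchedVar J T → ℝ}
    (hx : x ∈ KPoly (schedA prec T) (schedb J m T)) : LPFeasible prec m x := by
  constructor
  · intro j t
    simpa [schedA, schedb] using
      hx (Sum.inr (Sum.inr (Sum.inr (Sum.inr (Sum.inl (j, t))))))
  · intro j
    have h1 := hx (Sum.inl (Sum.inl j))
    have h2 := hx (Sum.inl (Sum.inr j))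
    simp only [schedA, schedb, Fintype.sum_sum_type, Fintype.sum_prod_type] at h1 h2
    simp at h1 h2
    linarith
  · intro t
    have h := hx (Sum.inr (Sum.inl t))
    simp only [schedA, schedb, Fintype.sum_sum_type, Fintype.sum_prod_type] at h
    simpa using h
  · intro i j hij t
    have h := hx (Sum.inr (Sum.inr (Sum.inl (i, j, t))))
    simp only [schedA, schedb, Fintype.sum_sum_type, Fintype.sum_prod_type, if_pos hij] at h
    simp only [add_mul, Finset.sum_add_distrib, ite_mul, one_mul, zero_mul, neg_mul,
      ite_and, Finset.sum_const_zero, add_zero] at h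
    rw [Finset.sum_comm, Finset.sum_comm (s := (Finset.univ : Finset J))] at h
    simp only [Finset.sum_ite_eq', Finset.mem_univ, if_true] at h
    have e : ∀ t' : Fin T, (if (t' : ℕ) + 1 ≤ t + 2 then -x (Sum.inl (j, t')) else 0) =
        -(if (t' : ℕ) ≤ t + 1 then x (Sum.inl (j, t')) else 0) := by
      intro t'
      by_cases hc : (t' : ℕ) ≤ t + 1
      · rw [if_pos hc, if_pos (by omega)]
      · rw [if_neg hc, if_neg (by omega), neg_zero]
    simp only [e, Finset.sum_neg_distrib] at h
    linarith
  · intro j I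
    have h1 := hx (Sum.inr (Sum.inr (Sum.inr (Sum.inl (Sum.inl (j, I))))))
    have h2 := hx (Sum.inr (Sum.inr (Sum.inr (Sum.inl (Sum.inr (j, I))))))
    simp only [schedA, schedb, Fintype.sum_sum_type, Fintype.sum_prod_type, ite_mul, one_mul,
      zero_mul, neg_mul, ite_and] at h1 h2
    rw [Finset.sum_comm, Finset.sum_comm (s := (Finset.univ : Finset J))] at h1 h2
    simp only [Finset.sum_ite_eq', Finset.mem_univ, if_true] at h1 h2
    have e : ∀ t : Fin T, (if memIv t I then -x (Sum.inl (j, t)) else 0) =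
        -(if memIv t I then x (Sum.inl (j, t)) else 0) := by
      intro t; split_ifs <;> simp
    simp only [e, Finset.sum_neg_distrib] at h1
    linarith

lemma LasSched.feasible {r : ℕ} {y : Finset (SchedVar J T) → ℝ} (hy : LasSched J prec m T r y) :
    LPFeasible prec m (fun v => y {v}) :=
  lpFeasible_of_mem_KPoly (InLasserre.singleton_mem_KPoly hy)

namespace LPFeasible

variable {x : SchedVar J T → ℝ}

lemma interval_le_one (hx : LPFeasible prec m x) (j : J) (I : Iv T) :
    x (Sum.inr (j, I)) ≤ 1 := by
  rw [hx.interval, ← hx.total j]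
  refine Finset.sum_le_sum fun t _ => ?_
  have := hx.nonneg j t
  split_ifs <;> simp [this]

lemma card_eq_one_le (hx : LPFeasible prec m x) (I : Iv T) :
    (Finset.univ.filter fun j : J => x (Sum.inr (j, I)) = 1).card ≤
      m * ((I.1.2 : ℕ) + 1 - (I.1.1 : ℕ)) := by
  have hI : (Finset.univ.filter fun t => memIv t I).card = (I.1.2 : ℕ) + 1 - (I.1.1 : ℕ) := by
    rw [← Fin.card_Icc]
    congr 1
    ext t
    rw [Finset.mem_filter, Finset.mem_Icc]
    exact and_iff_right (Finset.mem_univ t)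
  have hnn : ∀ j, 0 ≤ x (Sum.inr (j, I)) := by
    intro j
    rw [hx.interval]
    refine Finset.sum_nonneg fun t _ => ?_
    have := hx.nonneg j t
    split_ifs <;> simp [this]
  have h : ((Finset.univ.filter fun j : J => x (Sum.inr (j, I)) = 1).card : ℝ) ≤
      m * ((I.1.2 : ℕ) + 1 - (I.1.1 : ℕ) : ℕ) := by
    calc ((Finset.univ.filter fun j : J => x (Sum.inr (j, I)) = 1).card : ℝ)
        = ∑ j ∈ Finset.univ.filter (fun j : J => x (Sum.inr (j, I)) = 1),
            x (Sum.inr (j, I)) := by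
          rw [Finset.sum_congr rfl fun j hj => (Finset.mem_filter.1 hj).2]
          simp
      _ ≤ ∑ j, x (Sum.inr (j, I)) :=
          Finset.sum_le_sum_of_subset_of_nonneg (Finset.filter_subset _ _) fun j _ _ => hnn j
      _ = ∑ t ∈ Finset.univ.filter (fun t => memIv t I), ∑ j, x (Sum.inl (j, t)) := by
          simp only [hx.interval]
          rw [Finset.sum_comm, Finset.sum_filter]
          refine Finset.sum_congr rfl fun t _ => ?_
          split_ifs <;> simp
      _ ≤ ∑ t ∈ Finset.univ.filter (fun t => memIv t I), (m : ℝ) :=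
          Finset.sum_le_sum fun t _ => hx.capacity t
      _ = m * ((I.1.2 : ℕ) + 1 - (I.1.1 : ℕ) : ℕ) := by
          rw [Finset.sum_const, hI, nsmul_eq_mul, mul_comm]
  exact_mod_cast h

variable {I A B : Iv T}

lemma interval_eq_add (hx : LPFeasible prec m x) (hA : A.1.1 = I.1.1)
    (hAB : (A.1.2 : ℕ) + 1 = B.1.1) (hB : B.1.2 = I.1.2) (j : J) :
    x (Sum.inr (j, I)) = x (Sum.inr (j, A)) + x (Sum.inr (j, B)) := by
  rw [hx.interval, hx.interval, hx.interval, ← Finset.sum_add_distrib]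
  refine Finset.sum_congr rfl fun t _ => ?_
  have h1 : (A.1.1 : ℕ) = I.1.1 := congrArg _ hA
  have h2 : (B.1.2 : ℕ) = I.1.2 := congrArg _ hB
  have h3 : (A.1.1 : ℕ) ≤ A.1.2 := A.2
  have h4 : (B.1.1 : ℕ) ≤ B.1.2 := B.2
  simp only [memIv, Fin.le_def]
  split_ifs <;> first | omega | simp

lemma partialSum_add_interval_le (hx : LPFeasible prec m x) (hAB : (A.1.2 : ℕ) + 1 = B.1.1) (j : J) :
    (∑ t' : Fin T, if t' ≤ A.1.2 then x (Sum.inl (j, t')) else 0) + x (Sum.inr (j, B)) ≤ 1 := by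
  rw [hx.interval, ← hx.total j, ← Finset.sum_add_distrib]
  refine Finset.sum_le_sum fun t _ => ?_
  have := hx.nonneg j t
  simp only [memIv, Fin.le_def]
  split_ifs <;> first | omega | simp [this]

lemma interval_le_partialSum (hx : LPFeasible prec m x) (j : J) :
    x (Sum.inr (j, A)) ≤
      ∑ t' : Fin T, if (t' : ℕ) ≤ A.1.2 + 1 then x (Sum.inl (j, t')) else 0 := by
  rw [hx.interval]
  refine Finset.sum_le_sum fun t _ => ?_
  have := hx.nonneg j t
  simp only [memIv, Fin.le_def]
  split_ifs <;> first | omega | simp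

lemma right_of_prec (hx : LPFeasible prec m x) (hA : A.1.1 = I.1.1)
    (hAB : (A.1.2 : ℕ) + 1 = B.1.1) (hB : B.1.2 = I.1.2) {j j' : J} (hjj : prec j j')
    (hj : x (Sum.inr (j, B)) = 1) (hj' : x (Sum.inr (j', I)) = 1) :
    x (Sum.inr (j', B)) = 1 := by
  have h1 := hx.partialSum_add_interval_le hAB j
  have h2 := hx.precedence j j' hjj A.1.2
  have h3 := hx.interval_le_partialSum (A := A) j'
  have h4 := hx.interval_eq_add hA hAB hB j'
  have h5 := hx.interval_le_one j' B
  linarith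

lemma left_of_prec (hx : LPFeasible prec m x) (hA : A.1.1 = I.1.1)
    (hAB : (A.1.2 : ℕ) + 1 = B.1.1) (hB : B.1.2 = I.1.2) {j j' : J} (hjj : prec j' j)
    (hj : x (Sum.inr (j, A)) = 1) (hj' : x (Sum.inr (j', I)) = 1) :
    x (Sum.inr (j', A)) = 1 := by
  have h1 := hx.partialSum_add_interval_le hAB j'
  have h2 := hx.precedence j' j hjj A.1.2
  have h3 := hx.interval_le_partialSum (A := A) j
  have h4 := hx.interval_eq_add hA hAB hB j'
  have h5 := hx.interval_le_one j' A
  linarith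

end LPFeasible

end Feasible

section Dyadic

variable {T : ℕ} {Istar I : Iv T} {ℓ i : ℕ}

lemma IsSubDyadicOf.length (h : IsSubDyadicOf Istar I ℓ i) :
    (I.1.2 : ℕ) + 1 - (I.1.1 : ℕ) = ((Istar.1.2 : ℕ) + 1 - (Istar.1.1 : ℕ)) / 2 ^ ℓ := by
  obtain ⟨-, -, h1, h2⟩ := h
  rw [h1, h2, add_mul]
  omega

lemma IsSubDyadicOf.unique {I' : Iv T} (h : IsSubDyadicOf Istar I ℓ i)
    (h' : IsSubDyadicOf Istar I' ℓ i) : I = I' := by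
  obtain ⟨-, -, h1, h2⟩ := h
  obtain ⟨-, -, h1', h2'⟩ := h'
  refine Subtype.ext (Prod.ext (Fin.ext ?_) (Fin.ext ?_)) <;> omega

lemma IsSubDyadicOf.isDyadicOf {L : ℕ} (hIstar : IsDyadicOf T L Istar)
    (h : IsSubDyadicOf Istar I ℓ i) : IsDyadicOf T L I := by
  obtain ⟨ℓ₀, i₀, hℓ₀, hi₀, h1, h2⟩ := hIstar
  obtain ⟨hi, hd, h3, h4⟩ := h
  have hlen : (Istar.1.2 : ℕ) + 1 - (Istar.1.1 : ℕ) = 2 ^ (L - ℓ₀) := by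
    rw [h1, h2, add_mul]; omega
  rw [hlen] at hd h3 h4
  have hle : ℓ ≤ L - ℓ₀ := (Nat.pow_dvd_pow_iff_le_right (by norm_num)).1 hd
  rw [Nat.pow_div hle (by norm_num)] at h3 h4
  have e1 : L - (ℓ₀ + ℓ) = L - ℓ₀ - ℓ := by omega
  have e2 : (2 : ℕ) ^ (L - ℓ₀) = 2 ^ ℓ * 2 ^ (L - ℓ₀ - ℓ) := by
    rw [← pow_add]; congr 1; omega
  refine ⟨ℓ₀ + ℓ, i₀ * 2 ^ ℓ + i, by omega, ?_, ?_, ?_⟩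
  · have : (i₀ + 1) * 2 ^ ℓ ≤ 2 ^ ℓ₀ * 2 ^ ℓ := Nat.mul_le_mul_right _ hi₀
    rw [pow_add]
    linarith
  · rw [e1, h3, h1, e2]; ring
  · rw [e1, h4, h1, e2]; ring

lemma IsSubDyadicOf.exists_halves (h : IsSubDyadicOf Istar I ℓ i)
    (hd : 2 ^ (ℓ + 1) ∣ ((Istar.1.2 : ℕ) + 1 - (Istar.1.1 : ℕ))) :
    ∃ A B : Iv T, IsHalf I A ∧ IsHalf I B ∧ IsSubDyadicOf Istar A (ℓ + 1) (2 * i) ∧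
      IsSubDyadicOf Istar B (ℓ + 1) (2 * i + 1) ∧
      A.1.1 = I.1.1 ∧ (A.1.2 : ℕ) + 1 = B.1.1 ∧ B.1.2 = I.1.2 := by
  have hlen := h.length
  obtain ⟨hi, -, h1, h2⟩ := h
  have hle : (Istar.1.1 : ℕ) ≤ Istar.1.2 := Istar.2
  obtain ⟨c, hc⟩ := hd
  have hc0 : 0 < c := by
    rcases Nat.eq_zero_or_pos c with rfl | h
    · omega
    · exact h
  have q1 : ((Istar.1.2 : ℕ) + 1 - (Istar.1.1 : ℕ)) / 2 ^ ℓ = 2 * c := by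
    rw [hc, pow_succ, mul_assoc, Nat.mul_div_cancel_left _ (by positivity)]
  have q2 : ((Istar.1.2 : ℕ) + 1 - (Istar.1.1 : ℕ)) / 2 ^ (ℓ + 1) = c := by
    rw [hc, Nat.mul_div_cancel_left _ (by positivity)]
  rw [q1] at h1 h2 hlen
  have hI2 := I.1.2.2
  have s1 : (I.1.2 : ℕ) + 1 = I.1.1 + 2 * c := by rw [h1, h2]; ring
  refine ⟨⟨(I.1.1, ⟨I.1.1 + c - 1, by omega⟩), by simp only [Fin.le_def]; omega⟩,
    ⟨(⟨I.1.1 + c, by omega⟩, I.1.2), by simp only [Fin.le_def]; omega⟩,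
    ⟨c, hlen, Or.inl ⟨rfl, ?_⟩⟩, ⟨c, hlen, Or.inr ⟨rfl, rfl⟩⟩,
    ⟨?_, ⟨c, hc⟩, ?_, ?_⟩, ⟨?_, ⟨c, hc⟩, ?_, ?_⟩, rfl, ?_, rfl⟩
  · simp only; omega
  · rw [pow_succ]; omega
  · rw [q2]; simp only [h1]; ring
  · rw [q2]; simp only [h1]
    have : (2 * i + 1) * c = i * (2 * c) + c := by ring
    omega
  · rw [pow_succ]; omega
  · rw [q2]; simp only [h1]; ring
  · rw [q2]; simp only [h2]; ring
  · simp only; omega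

end Dyadic

section Potential

variable {J : Type} [Fintype J] {prec : J → J → Prop} {m T : ℕ}

/-- The pairs `(j, I)` with `y_{j,I} = 1` and `I` in one of the levels `1, …, K` of the dyadic
dissection of `Istar`. -/
def placedPairs (Istar : Iv T) (K : ℕ) (y : Finset (SchedVar J T) → ℝ) : Finset (J × Iv T) :=
  Finset.univ.filter fun p =>
    (∃ ℓ i : ℕ, ℓ ∈ Finset.Icc 1 K ∧ IsSubDyadicOf Istar p.2 ℓ i) ∧ y {Sum.inr p} = 1

lemma card_placedPairs_le (Istar : Iv T) (K : ℕ) {y : Finset (SchedVar J T) → ℝ}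
    (hy : LPFeasible prec m (fun v => y {v})) :
    (placedPairs Istar K y).card ≤ K * (m * ((Istar.1.2 : ℕ) + 1 - (Istar.1.1 : ℕ))) := by
  set N := (Istar.1.2 : ℕ) + 1 - (Istar.1.1 : ℕ) with hN
  let F : ℕ → ℕ → Finset (J × Iv T) := fun ℓ i =>
    Finset.univ.filter fun p => IsSubDyadicOf Istar p.2 ℓ i ∧ y {Sum.inr p} = 1
  have hF : ∀ ℓ i, (F ℓ i).card ≤ m * (N / 2 ^ ℓ) := by
    intro ℓ i
    rcases (F ℓ i).eq_empty_or_nonempty with he | ⟨⟨j₀, I⟩, hp⟩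
    · simp [he]
    · have hI := (Finset.mem_filter.1 hp).2.1
      calc (F ℓ i).card
          ≤ ((Finset.univ.filter fun j : J => y {Sum.inr (j, I)} = 1).image
              fun j => (j, I)).card := by
            refine Finset.card_le_card fun p hp' => ?_
            obtain ⟨j, I'⟩ := p
            obtain ⟨-, hs, h1⟩ := Finset.mem_filter.1 hp'
            obtain rfl := hI.unique hs
            exact Finset.mem_image.2 ⟨j, by simpa using h1, rfl⟩
        _ ≤ (Finset.univ.filter fun j : J => y {Sum.inr (j, I)} = 1).card :=
            Finset.card_image_le
        _ ≤ m * (N / 2 ^ ℓ) := by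
            rw [hN, ← hI.length]
            exact hy.card_eq_one_le I
  calc (placedPairs Istar K y).card
      ≤ ((Finset.Icc 1 K).biUnion fun ℓ => (Finset.range (2 ^ ℓ)).biUnion (F ℓ)).card := by
        refine Finset.card_le_card fun p hp => ?_
        obtain ⟨-, ⟨ℓ, i, hℓ, hs⟩, h1⟩ := Finset.mem_filter.1 hp
        exact Finset.mem_biUnion.2 ⟨ℓ, hℓ, Finset.mem_biUnion.2
          ⟨i, Finset.mem_range.2 hs.1, Finset.mem_filter.2 ⟨Finset.mem_univ _, hs, h1⟩⟩⟩
    _ ≤ ∑ ℓ ∈ Finset.Icc 1 K, ∑ i ∈ Finset.range (2 ^ ℓ), (F ℓ i).card :=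
        Finset.card_biUnion_le.trans (Finset.sum_le_sum fun ℓ _ => Finset.card_biUnion_le)
    _ ≤ ∑ ℓ ∈ Finset.Icc 1 K, m * N := by
        refine Finset.sum_le_sum fun ℓ _ =>
          (Finset.sum_le_sum fun i _ => hF ℓ i).trans ?_
        rw [Finset.sum_const, Finset.card_range, smul_eq_mul, mul_left_comm]
        exact Nat.mul_le_mul_left _ (Nat.mul_div_le _ _)
    _ = K * (m * N) := by simp

lemma card_placedPairs_add_le {Istar I : Iv T} {K ℓ i : ℕ} {y z : Finset (SchedVar J T) → ℝ}
    (hmono : ∀ w, y {w} = 1 → z {w} = 1) (hℓ : ℓ ∈ Finset.Icc 1 K)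
    (hI : IsSubDyadicOf Istar I ℓ i) (S : Finset J) (hy : ∀ j ∈ S, y {Sum.inr (j, I)} < 1)
    (hz : ∀ j ∈ S, z {Sum.inr (j, I)} = 1) :
    (placedPairs Istar K y).card + S.card ≤ (placedPairs Istar K z).card := by
  have hinj : Function.Injective fun j : J => (j, I) := fun a b h => congrArg Prod.fst h
  rw [← Finset.card_image_of_injective S hinj, ← Finset.card_union_of_disjoint]
  · refine Finset.card_le_card (Finset.union_subset (fun p hp => ?_) fun p hp => ?_)
    · obtain ⟨-, h1, h2⟩ := Finset.mem_filter.1 hp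
      exact Finset.mem_filter.2 ⟨Finset.mem_univ _, h1, hmono _ h2⟩
    · obtain ⟨j, hj, rfl⟩ := Finset.mem_image.1 hp
      exact Finset.mem_filter.2 ⟨Finset.mem_univ _, ⟨ℓ, i, hℓ, hI⟩, hz j hj⟩
  · refine Finset.disjoint_left.2 fun p hp hp' => ?_
    obtain ⟨j, hj, rfl⟩ := Finset.mem_image.1 hp'
    exact (hy j hj).ne (Finset.mem_filter.1 hp).2.2

/-- A job owned by `I` with many related jobs owned by `I` admits a conditioning that moves more
than half of them down to a child of `I`. -/
lemma exists_condStep {L : ℕ} (hirr : ∀ j, ¬ prec j j) {Istar I : Iv T}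
    (hIstar : IsDyadicOf T L Istar) {K : ℕ}
    (hK : 2 ^ K ∣ ((Istar.1.2 : ℕ) + 1 - (Istar.1.1 : ℕ))) {r : ℕ}
    {y : Finset (SchedVar J T) → ℝ} (hy : LasSched J prec m T (r + 1) y) {ℓ i : ℕ} (hℓ : ℓ < K)
    (hI : IsSubDyadicOf Istar I ℓ i) {j : J} (hj : OwnedBy y I j) :
    ∃ z, CondStepDyadic T L y z ∧ LasSched J prec m T r z ∧
      2 * (placedPairs Istar K y).card + ((Finset.univ.filter
        (fun j' => OwnedBy y I j' ∧ (prec j j' ∨ prec j' j))).card + 1) ≤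
      2 * (placedPairs Istar K z).card := by
  obtain ⟨A, B, hIA, hIB, hsA, hsB, hA, hAB, hB⟩ :=
    hI.exists_halves ((pow_dvd_pow 2 hℓ).trans hK)
  have hℓ' : ℓ + 1 ∈ Finset.Icc 1 K := Finset.mem_Icc.2 ⟨by omega, hℓ⟩
  have hsum := hy.feasible.interval_eq_add hA hAB hB j
  have hjI := hj.1
  have hjA := hj.2 A hIA
  have hjB := hj.2 B hIB
  have step : ∀ (C : Iv T) (n : ℕ) (R : J → Prop), IsHalf I C →
      IsSubDyadicOf Istar C (ℓ + 1) n → 0 < y {Sum.inr (j, C)} → ¬ R j →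
      (∀ x : SchedVar J T → ℝ, LPFeasible prec m x → ∀ j', R j' → x (Sum.inr (j, C)) = 1 →
        x (Sum.inr (j', I)) = 1 → x (Sum.inr (j', C)) = 1) →
      ∃ z, CondStepDyadic T L y z ∧ LasSched J prec m T r z ∧
        (placedPairs Istar K y).card +
          ((Finset.univ.filter (fun j' => OwnedBy y I j' ∧ R j')).card + 1) ≤
        (placedPairs Istar K z).card := by
    intro C n R hIC hsC hpos hR hprop
    let z : Finset (SchedVar J T) → ℝ :=
      fun S => y (insert (Sum.inr (j, C)) S) / y {Sum.inr (j, C)}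
    have hzdef : ∀ S, z S = y (insert (Sum.inr (j, C)) S) / y {Sum.inr (j, C)} := fun S => rfl
    have hz : LasSched J prec m T r z := InLasserre.cond hy hpos hzdef
    have hmono : ∀ w, y {w} = 1 → z {w} = 1 :=
      fun w hw => InLasserre.cond_eq_one hy hpos hzdef hw
    have hzj : z {Sum.inr (j, C)} = 1 := by
      rw [hzdef, Finset.insert_eq_of_mem (Finset.mem_singleton_self _), div_self hpos.ne']
    refine ⟨z, ⟨j, C, hsC.isDyadicOf hIstar, hpos, hzdef⟩, hz, ?_⟩
    have hnot : j ∉ Finset.univ.filter (fun j' => OwnedBy y I j' ∧ R j') := by simp [hR]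
    rw [← Finset.card_insert_of_notMem hnot]
    refine card_placedPairs_add_le hmono hℓ' hsC _ (fun j' hj' => ?_) fun j' hj' => ?_
    · rcases Finset.mem_insert.1 hj' with rfl | h
      · exact hj.2 C hIC
      · exact (Finset.mem_filter.1 h).2.1.2 C hIC
    · rcases Finset.mem_insert.1 hj' with rfl | h
      · exact hzj
      · obtain ⟨-, h1, h2⟩ := Finset.mem_filter.1 h
        exact hprop _ hz.feasible j' h2 hzj (hmono _ h1.1)
  have hcard : (Finset.univ.filter
      (fun j' => OwnedBy y I j' ∧ (prec j j' ∨ prec j' j))).card ≤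
      (Finset.univ.filter (fun j' => OwnedBy y I j' ∧ prec j j')).card +
      (Finset.univ.filter (fun j' => OwnedBy y I j' ∧ prec j' j)).card := by
    refine le_trans (Finset.card_le_card fun j' hj' => ?_) (Finset.card_union_le _ _)
    simp only [Finset.mem_union, Finset.mem_filter, Finset.mem_univ, true_and] at hj' ⊢
    tauto
  rcases le_total (Finset.univ.filter (fun j' => OwnedBy y I j' ∧ prec j' j)).card
    (Finset.univ.filter (fun j' => OwnedBy y I j' ∧ prec j j')).card with hle | hle
  · obtain ⟨z, h1, h2, h3⟩ := step B _ (fun j' => prec j j') hIB hsB (by linarith) (hirr j)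
      fun x hx j' hR => hx.right_of_prec hA hAB hB hR
    exact ⟨z, h1, h2, by omega⟩
  · obtain ⟨z, h1, h2, h3⟩ := step A _ (fun j' => prec j' j) hIA hsA (by linarith) (hirr j)
      fun x hx j' hR => hx.left_of_prec hA hAB hB hR
    exact ⟨z, h1, h2, by omega⟩

end Potential

/-- Breaking long chains: from `y* ∈ Las_{r*}(K(T))` with `r* ≥ 2mk²2^{k²}/δ`, a sequence of at
most `2mk²·2^{k²}/δ` conditionings on events `x_{j,I} = 1` (`I` dyadic) yields
`y** ∈ Las_{r**}(K(T))` with `r** = r* − ⌈2mk²·2^{k²}/δ⌉` such that `Δ(J(I,y**)) ≤ δ|I|` for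
every interval `I` of the first `k²` levels of the dyadic dissection of `I*`. -/
theorem statement8 (J : Type) [Fintype J] (prec : J → J → Prop)
    (hirr : ∀ j, ¬ prec j j)
    (htrans : ∀ j₁ j₂ j₃, prec j₁ j₂ → prec j₂ j₃ → prec j₁ j₃)
    (m L T : ℕ) (hT : T = 2 ^ L)
    (Istar : Iv T) (hIstar : IsDyadicOf T L Istar)
    (Tstar : ℕ) (hTstar : Tstar = (Istar.1.2 : ℕ) + 1 - (Istar.1.1 : ℕ))
    (k : ℕ) (hk : 1 ≤ k) (hk2 : (k ^ 2 : ℝ) ≤ Real.logb 2 Tstar)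
    (δ : ℝ) (hδ : 0 < δ)
    (rstar : ℕ) (hr : (2 * (m : ℝ) * (k : ℝ) ^ 2 * 2 ^ (k ^ 2)) / δ ≤ (rstar : ℝ))
    (y : Finset (SchedVar J T) → ℝ) (hy : LasSched J prec m T rstar y) :
    ∃ (s : ℕ) (f : ℕ → Finset (SchedVar J T) → ℝ),
      (s : ℝ) ≤ (2 * (m : ℝ) * (k : ℝ) ^ 2 * 2 ^ (k ^ 2)) / δ ∧
      f 0 = y ∧
      (∀ i < s, CondStepDyadic T L (f i) (f (i + 1))) ∧
      LasSched J prec m T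
        (rstar - ⌈(2 * (m : ℝ) * (k : ℝ) ^ 2 * 2 ^ (k ^ 2)) / δ⌉₊) (f s) ∧
      ∀ I : Iv T, (∃ ℓ i : ℕ, ℓ < k ^ 2 ∧ IsSubDyadicOf Istar I ℓ i) →
        ∀ j : J, OwnedBy (f s) I j →
          ((Finset.univ.filter
              (fun j' => OwnedBy (f s) I j' ∧ (prec j j' ∨ prec j' j))).card + 1 : ℝ)
            ≤ δ * ((I.1.2 : ℕ) + 1 - (I.1.1 : ℕ) : ℕ) := by
  subst hTstar
  have hle : (Istar.1.1 : ℕ) ≤ Istar.1.2 := Istar.2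
  set N := (Istar.1.2 : ℕ) + 1 - (Istar.1.1 : ℕ) with hN
  have hN0 : 0 < N := by omega
  have hNr : (0 : ℝ) < N := by exact_mod_cast hN0
  have hK : 2 ^ (k ^ 2) ∣ N := by
    obtain ⟨ℓ₀, i₀, -, -, h1, h2⟩ := hIstar
    have hlen : N = 2 ^ (L - ℓ₀) := by rw [hN, h1, h2, add_mul]; omega
    rw [hlen] at hk2 ⊢
    refine pow_dvd_pow 2 ?_
    have : Real.logb 2 ((2 ^ (L - ℓ₀) : ℕ) : ℝ) = (L - ℓ₀ : ℕ) := by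
      push_cast
      rw [Real.logb_pow, Real.logb_self_eq_one (by norm_num), mul_one]
    rw [this] at hk2
    exact_mod_cast hk2
  set C := (2 * (m : ℝ) * (k : ℝ) ^ 2 * 2 ^ (k ^ 2)) / δ with hC
  have hC0 : 0 ≤ C := by positivity
  have hbound : ∀ (s r : ℕ) (z : Finset (SchedVar J T) → ℝ), LasSched J prec m T r z →
      (s : ℝ) * (δ * N / 2 ^ (k ^ 2)) ≤ (placedPairs Istar (k ^ 2) z).card →
      (s : ℝ) ≤ C / 2 := by
    intro s r z hz hs
    have h : ((placedPairs Istar (k ^ 2) z).card : ℝ) ≤ k ^ 2 * (m * N) := by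
      exact_mod_cast card_placedPairs_le Istar (k ^ 2) hz.feasible
    have h2 := hs.trans h
    have e : C / 2 = (k ^ 2 * (m * N)) / (δ * N / 2 ^ (k ^ 2)) := by
      rw [hC]; field_simp
    rw [e, le_div_iff₀ (by positivity)]
    exact h2
  by_contra hcon
  have hall : ∀ s : ℕ, ∃ f : ℕ → Finset (SchedVar J T) → ℝ, f 0 = y ∧
      (∀ i < s, CondStepDyadic T L (f i) (f (i + 1))) ∧
      LasSched J prec m T (rstar - s) (f s) ∧
      (s : ℝ) * (δ * N / 2 ^ (k ^ 2)) ≤ (placedPairs Istar (k ^ 2) (f s)).card := by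
    intro s
    induction s with
    | zero => exact ⟨fun _ => y, rfl, by simp, hy, by simp⟩
    | succ s ih =>
      obtain ⟨f, hf0, hstep, hlas, hpot⟩ := ih
      have hsC := hbound s _ _ hlas hpot
      have hviol : ∃ I : Iv T, (∃ ℓ i : ℕ, ℓ < k ^ 2 ∧ IsSubDyadicOf Istar I ℓ i) ∧
          ∃ j : J, OwnedBy (f s) I j ∧ δ * ((I.1.2 : ℕ) + 1 - (I.1.1 : ℕ) : ℕ) <
            ((Finset.univ.filter
              (fun j' => OwnedBy (f s) I j' ∧ (prec j j' ∨ prec j' j))).card + 1 : ℝ) := by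
        by_contra hno
        push Not at hno
        refine hcon ⟨s, f, by linarith, hf0, hstep, ?_, hno⟩
        refine InLasserre.mono ?_ hlas
        have : s ≤ ⌈C⌉₊ := by
          exact_mod_cast (show (s : ℝ) ≤ C by linarith).trans (Nat.le_ceil C)
        omega
      obtain ⟨I, ⟨ℓ, i, hℓ, hI⟩, j, hj, hlt⟩ := hviol
      have hm : 0 < m := by
        have h1 := hlas.feasible.card_eq_one_le I
        have h2 : 0 < (Finset.univ.filter fun j : J => f s {Sum.inr (j, I)} = 1).card :=
          Finset.card_pos.2 ⟨j, by simpa using hj.1⟩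
        exact Nat.pos_of_mul_pos_right (h2.trans_le h1)
      have hCpos : 0 < C := by
        have : (0 : ℝ) < m := by exact_mod_cast hm
        have : (0 : ℝ) < k := by exact_mod_cast hk
        positivity
      have hsr : s < rstar := by exact_mod_cast (show (s : ℝ) < rstar by linarith)
      rw [show rstar - s = (rstar - (s + 1)) + 1 by omega] at hlas
      obtain ⟨z, hz1, hz2, hz3⟩ := exists_condStep hirr hIstar hK hlas hℓ hI hj
      refine ⟨fun n => if n ≤ s then f n else z, by simpa using hf0, fun n hn => ?_, ?_, ?_⟩
      · rcases Nat.lt_succ_iff_lt_or_eq.1 hn with h | rfl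
        · simpa [h.le, Nat.succ_le_iff.2 h] using hstep n h
        · simpa using hz1
      · simpa using hz2
      · have hz3' : 2 * ((placedPairs Istar (k ^ 2) (f s)).card : ℝ) + ((Finset.univ.filter
            (fun j' => OwnedBy (f s) I j' ∧ (prec j j' ∨ prec j' j))).card + 1) ≤
            2 * (placedPairs Istar (k ^ 2) z).card := by exact_mod_cast hz3
        have hlen : (2 : ℝ) * (N / 2 ^ (k ^ 2)) ≤ ((I.1.2 : ℕ) + 1 - (I.1.1 : ℕ) : ℕ) := by
          rw [hI.length, Nat.cast_div hI.2.1 (by positivity), ← mul_div_assoc, ← hN,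
            div_le_div_iff₀ (by positivity) (by positivity)]
          push_cast
          have : (2 : ℝ) ^ (ℓ + 1) ≤ 2 ^ (k ^ 2) := pow_le_pow_right₀ (by norm_num) hℓ
          rw [pow_succ] at this
          nlinarith
        have := mul_le_mul_of_nonneg_left hlen hδ.le
        have e : δ * (2 * (N / 2 ^ (k ^ 2))) = 2 * (δ * N / 2 ^ (k ^ 2)) := by ring
        simp only [show ¬ (s + 1 ≤ s) by omega, if_false]
        push_cast
        linarith
  obtain ⟨f, -, -, hlas, hpot⟩ := hall (⌈C⌉₊ + 1)
  have h1 := hbound _ _ _ hlas hpot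
  have h2 := Nat.le_ceil C
  push_cast at h1
  linarith

end SchedLP

end
end

section
/- Let p, m, s be positive integers and k ≥ 1 an integer. Let U = {1,…,p} with integer capacities c_i satisfying 0 ≤ c_i ≤ m·s for each i ∈ U. Let V be a finite set where each v ∈ V has integers a_v, b_v; define the window W(v) = {i ∈ U : a_v ≤ i ≤ b_v} and the extended window W⁺(v) = {i ∈ U : max(a_v − 1, 1) ≤ i ≤ min(b_v + 1, p)}. Assume: (i) there is a fractional assignment x : V × U → [0,1] with ∑_{i∈U} x(v,i) = 1 for all v ∈ V, x(v,i) = 0 whenever i ∉ W⁺(v), and ∑_{v∈V} x(v,i) ≤ c_i for all i ∈ U; (ii) there is a set M ⊆ {1,…,p−1} with |M| ≤ 2p·2^{−k} such that for every v ∈ V there exists π ∈ M with {π, π+1} ⊆ W⁺(v). Then there exist a subset V' ⊆ V with |V ∖ V'| ≤ 2·m·s·|M| ≤ 4·m·s·p·2^{−k} and a map φ : V' → U with φ(v) ∈ W(v) for every v ∈ V' and |φ^{-1}(i)| ≤ c_i for every i ∈ U. -/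
open scoped Classical

noncomputable section

/-- Hall's theorem with capacities `c` on the right-hand side and deficiency `d`. -/
theorem exists_capacitated_assignment_of_deficiency {V U : Type*} [Fintype V]
    [DecidableEq U] [Inhabited U] (c : U → ℕ) (W : V → Finset U) (d : ℕ)
    (h : ∀ S : Finset V, S.card ≤ ∑ i ∈ S.biUnion W, c i + d) :
    ∃ (V' : Finset V) (φ : V → U), (Finset.univ \ V').card ≤ d ∧ (∀ v ∈ V', φ v ∈ W v) ∧
      ∀ i : U, (V'.filter (fun v => φ v = i)).card ≤ c i := by
  let t : V → Finset ((Σ _ : U, ℕ) ⊕ Fin d) := fun v =>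
    ((W v).sigma fun i => Finset.range (c i)).disjSum Finset.univ
  have hall : ∀ S : Finset V, S.card ≤ (S.biUnion t).card := by
    intro S
    rcases S.eq_empty_or_nonempty with rfl | ⟨v₀, hv₀⟩
    · simp
    have hsub : ((S.biUnion W).sigma fun i => Finset.range (c i)).disjSum
        (Finset.univ : Finset (Fin d)) ⊆ S.biUnion t := by
      rintro (⟨i, n⟩ | y) hy
      · simpa [t, and_assoc, ← exists_and_right] using hy
      · simpa [t] using ⟨v₀, hv₀⟩
    refine (h S).trans (le_trans (le_of_eq ?_) (Finset.card_le_card hsub))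
    simp [Finset.card_disjSum, Finset.card_sigma]
  obtain ⟨f, hf, hft⟩ := (Finset.all_card_le_biUnion_card_iff_exists_injective t).1 hall
  refine ⟨Finset.univ.filter fun v => (f v).isLeft,
    fun v => Sum.elim (fun y => y.1) (fun _ => default) (f v), ?_, ?_, ?_⟩
  · have hsub : ∀ v ∈ Finset.univ \ Finset.univ.filter (fun v => (f v).isLeft),
        f v ∈ (Finset.univ : Finset (Fin d)).map Function.Embedding.inr := by
      intro v hv
      rcases hfv : f v with y | y <;> simp_all
    simpa using Finset.card_le_card_of_injOn f hsub hf.injOn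
  · intro v hv
    have := hft v
    rcases hfv : f v with y | y <;> simp_all [t]
  · intro i
    have hsub : ∀ v ∈ (Finset.univ.filter fun v => (f v).isLeft).filter
          (fun v => Sum.elim (fun y => y.1) (fun _ => default) (f v) = i),
        f v ∈ (Finset.range (c i)).image
          (fun n => (Sum.inl ⟨i, n⟩ : (Σ _ : U, ℕ) ⊕ Fin d)) := by
      intro v hv
      have hv' := hft v
      rcases hfv : f v with ⟨j, n⟩ | y
      · simp only [Finset.mem_filter, hfv, Sum.elim_inl] at hv
        obtain ⟨-, rfl⟩ := hv
        simp [t, hfv] at hv'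
        simp [hv'.2]
      · simp [hfv] at hv
    refine (Finset.card_le_card_of_injOn f hsub hf.injOn).trans (Finset.card_image_le.trans ?_)
    simp

/-- If each interval `[a v - 1, b v + 1]` contains two consecutive points `π, π + 1` with `π ∈ M`,
then shrinking all the intervals by one at both ends removes at most `2 |M|` points from the
union. -/
theorem card_biUnion_Icc_sdiff_le {V : Type*} (S : Finset V) (a b : V → ℤ) (U M : Finset ℤ)
    (hM : ∀ v ∈ S, ∃ π ∈ M, a v - 1 ≤ π ∧ π ≤ b v) :
    ((S.biUnion fun v => Finset.Icc (a v - 1) (b v + 1) ∩ U) \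
      S.biUnion fun v => Finset.Icc (a v) (b v) ∩ U).card ≤ 2 * M.card := by
  rcases S.eq_empty_or_nonempty with rfl | ⟨v₀, -⟩
  · simp
  have : Nonempty V := ⟨v₀⟩
  choose! q hqM hqa hqb using hM
  set E := (S.biUnion fun v => Finset.Icc (a v - 1) (b v + 1) ∩ U) \
    S.biUnion fun v => Finset.Icc (a v) (b v) ∩ U with hE
  have hout : ∀ i ∈ E, ∀ w ∈ S, i < a w ∨ b w < i := by
    intro i hi w hw
    simp only [hE, Finset.mem_sdiff, Finset.mem_biUnion, Finset.mem_inter, Finset.mem_Icc] at hi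
    obtain ⟨⟨v, -, -, hU⟩, hn⟩ := hi
    by_contra! hcon
    exact hn ⟨w, hw, hcon, hU⟩
  have hin : ∀ i ∈ E, ∃ v ∈ S, a v - 1 ≤ i ∧ i ≤ b v + 1 := by
    intro i hi
    simp only [hE, Finset.mem_sdiff, Finset.mem_biUnion, Finset.mem_inter, Finset.mem_Icc] at hi
    obtain ⟨⟨v, hv, h, -⟩, -⟩ := hi
    exact ⟨v, hv, h⟩
  choose! g hgS hga hgb using hin
  have hcard : E.card ≤ (M ×ˢ (Finset.univ : Finset Bool)).card := by
    refine Finset.card_le_card_of_injOn (fun i => (q (g i), decide (i ≤ q (g i)))) ?_ ?_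
    · intro i hi
      exact Finset.mem_coe.2 (Finset.mem_product.2 ⟨hqM _ (hgS i hi), Finset.mem_univ _⟩)
    · intro i hi j hj hij
      simp only [Prod.mk.injEq, decide_eq_decide] at hij
      obtain ⟨hq, hle⟩ := hij
      have hii := hout i hi _ (hgS i hi)
      have hij := hout i hi _ (hgS j hj)
      have hji := hout j hj _ (hgS i hi)
      have hjj := hout j hj _ (hgS j hj)
      have := hga i hi
      have := hgb i hi
      have := hga j hj
      have := hgb j hj
      have := hqa _ (hgS i hi)
      have := hqb _ (hgS i hi)
      have := hqa _ (hgS j hj)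
      have := hqb _ (hgS j hj)
      omega
  simpa [Finset.card_product, mul_comm] using hcard

/-- A set of elements which is fractionally assigned within capacities has at most as many
elements as its neighbourhood has capacity. -/
theorem card_le_sum_capacity_of_fractional {V ι : Type*} [Fintype V] [DecidableEq ι] (U : Finset ι)
    (c : ι → ℕ) (x : V → ι → ℝ) (N : V → Finset ι) (hN : ∀ v, N v ⊆ U)
    (hx : ∀ v i, 0 ≤ x v i) (hxsum : ∀ v, ∑ i ∈ U, x v i = 1)
    (hxsupp : ∀ v, ∀ i, i ∉ N v → x v i = 0)
    (hxcap : ∀ i ∈ U, ∑ v, x v i ≤ (c i : ℝ)) (S : Finset V) :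
    S.card ≤ ∑ i ∈ S.biUnion N, c i := by
  have hsub : S.biUnion N ⊆ U := Finset.biUnion_subset.2 fun v _ => hN v
  have : (S.card : ℝ) ≤ ∑ i ∈ S.biUnion N, (c i : ℝ) :=
    calc (S.card : ℝ) = ∑ v ∈ S, ∑ i ∈ U, x v i := by simp [hxsum]
      _ = ∑ v ∈ S, ∑ i ∈ S.biUnion N, x v i := by
        refine Finset.sum_congr rfl fun v hv => (Finset.sum_subset hsub fun i _ hi => ?_).symm
        exact hxsupp v i fun h => hi (Finset.mem_biUnion.2 ⟨v, hv, h⟩)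
      _ = ∑ i ∈ S.biUnion N, ∑ v ∈ S, x v i := Finset.sum_comm
      _ ≤ ∑ i ∈ S.biUnion N, (c i : ℝ) := Finset.sum_le_sum fun i hi =>
        (Finset.sum_le_univ_sum_of_nonneg fun v => hx v i).trans (hxcap i (hsub hi))
  exact_mod_cast this

/-- The matching step for placing the top jobs. `U = {1,…,p}` are subintervals with capacities
`c_i ≤ m·s`; each `v ∈ V` has a window `W(v) = {i ∈ U : a_v ≤ i ≤ b_v}` and an extended window
`W⁺(v) = {i ∈ U : a_v − 1 ≤ i ≤ b_v + 1}`. If there is a capacity-respecting fractional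
assignment supported on the extended windows, and a set `M ⊆ {1,…,p−1}` of at most `2p·2^{−k}`
midpoints such that every extended window contains two consecutive points `π, π+1` with
`π ∈ M`, then all but at most `2ms·|M| ≤ 4msp·2^{−k}` elements of `V` can be integrally
assigned inside their (non-extended) windows, respecting the capacities. -/
theorem statement10 (p m s k : ℕ) (hp : 0 < p) (hm : 0 < m) (hs : 0 < s) (hk : 1 ≤ k)
    (c : ℤ → ℕ) (hc : ∀ i ∈ Finset.Icc (1 : ℤ) p, c i ≤ m * s)
    (V : Type) [Fintype V] (a b : V → ℤ)
    (x : V → ℤ → ℝ)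
    (hx01 : ∀ (v : V) (i : ℤ), 0 ≤ x v i ∧ x v i ≤ 1)
    (hxsum : ∀ v : V, ∑ i ∈ Finset.Icc (1 : ℤ) p, x v i = 1)
    (hxsupp : ∀ (v : V) (i : ℤ),
      i ∉ Finset.Icc (a v - 1) (b v + 1) ∩ Finset.Icc (1 : ℤ) p → x v i = 0)
    (hxcap : ∀ i ∈ Finset.Icc (1 : ℤ) p, ∑ v : V, x v i ≤ (c i : ℝ))
    (M : Finset ℤ) (hM : M ⊆ Finset.Icc (1 : ℤ) (p - 1))
    (hMcard : (M.card : ℝ) ≤ 2 * p * 2 ^ (-(k : ℝ)))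
    (hMmid : ∀ v : V, ∃ π ∈ M,
      π ∈ Finset.Icc (a v - 1) (b v + 1) ∩ Finset.Icc (1 : ℤ) p ∧
      π + 1 ∈ Finset.Icc (a v - 1) (b v + 1) ∩ Finset.Icc (1 : ℤ) p) :
    ∃ (V' : Finset V) (φ : V → ℤ),
      ((Finset.univ \ V').card : ℝ) ≤ 2 * m * s * M.card ∧
      ((Finset.univ \ V').card : ℝ) ≤ 4 * m * s * p * 2 ^ (-(k : ℝ)) ∧
      (∀ v ∈ V', φ v ∈ Finset.Icc (a v) (b v) ∩ Finset.Icc (1 : ℤ) p) ∧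
      (∀ i : ℤ, (V'.filter (fun v => φ v = i)).card ≤ c i) := by
  have hall : ∀ S : Finset V, S.card ≤
      ∑ i ∈ S.biUnion (fun v => Finset.Icc (a v) (b v) ∩ Finset.Icc (1 : ℤ) p), c i +
        2 * m * s * M.card := by
    intro S
    have hfrac := card_le_sum_capacity_of_fractional (Finset.Icc (1 : ℤ) p) c x
      (fun v => Finset.Icc (a v - 1) (b v + 1) ∩ Finset.Icc (1 : ℤ) p)
      (fun v => Finset.inter_subset_right) (fun v i => (hx01 v i).1) hxsum hxsupp hxcap S
    have hcard := card_biUnion_Icc_sdiff_le S a b (Finset.Icc (1 : ℤ) p) M fun v _ => by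
      obtain ⟨π, hπ, h₁, h₂⟩ := hMmid v
      simp only [Finset.mem_inter, Finset.mem_Icc] at h₁ h₂
      exact ⟨π, hπ, by omega, by omega⟩
    set N := S.biUnion fun v => Finset.Icc (a v) (b v) ∩ Finset.Icc (1 : ℤ) p
    set N' := S.biUnion fun v => Finset.Icc (a v - 1) (b v + 1) ∩ Finset.Icc (1 : ℤ) p with hN'
    have hdiff : ∑ i ∈ N' \ N, c i ≤ (N' \ N).card * (m * s) := by
      refine Finset.sum_le_card_nsmul _ _ _ fun i hi => hc i ?_
      obtain ⟨v, -, hv⟩ := Finset.mem_biUnion.1 (Finset.mem_sdiff.1 hi).1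
      exact (Finset.mem_inter.1 hv).2
    calc S.card ≤ ∑ i ∈ N', c i := hfrac
      _ ≤ ∑ i ∈ N ∪ N' \ N, c i := Finset.sum_le_sum_of_subset fun i hi => by
        by_cases h : i ∈ N <;> simp [h, hi]
      _ = ∑ i ∈ N, c i + ∑ i ∈ N' \ N, c i := Finset.sum_union Finset.disjoint_sdiff
      _ ≤ ∑ i ∈ N, c i + 2 * M.card * (m * s) :=
        Nat.add_le_add_left (hdiff.trans (Nat.mul_le_mul_right _ hcard)) _
      _ = ∑ i ∈ N, c i + 2 * m * s * M.card := by ring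
  obtain ⟨V', φ, hd, hφ, hcap⟩ := exists_capacitated_assignment_of_deficiency c _ _ hall
  have hd' : ((Finset.univ \ V').card : ℝ) ≤ 2 * m * s * M.card := by exact_mod_cast hd
  refine ⟨V', φ, hd', hd'.trans ?_, hφ, hcap⟩
  calc (2 * m * s * M.card : ℝ) ≤ 2 * m * s * (2 * p * 2 ^ (-(k : ℝ))) := by gcongr
    _ = 4 * m * s * p * 2 ^ (-(k : ℝ)) := by ring

end
end

section
/- Let J be a finite set of unit-length jobs with a strict partial order ≺, integer release times r_j and deadlines d_j with 1 ≤ r_j ≤ d_j ≤ T, consistent with the precedence order (j ≺ j' implies r_j ≤ r_{j'} and d_j ≤ d_{j'}), and such that every chain of ≺ in J has at most C elements. Suppose the time horizon {1,…,T} is partitioned into p equally sized consecutive intervals I_1,…,I_p, every release time r_j is the first time unit of some I_i, and every deadline d_j is the last time unit of some I_i. Let cap : {1,…,T} → {0,…,m} be a capacity function, and assume there exists a map σ̃ : J → {1,…,T} with r_j ≤ σ̃(j) ≤ d_j for all j ∈ J and |σ̃^{-1}(t)| ≤ cap(t) for all t (precedence constraints within J not necessarily respected). Then there exist a set J_disc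 ⊆ J with |J_disc| ≤ p·m·C and a map σ : J ∖ J_disc → {1,…,T} with r_j ≤ σ(j) ≤ d_j for all j ∈ J ∖ J_disc, |σ^{-1}(t)| ≤ cap(t) for all t, and σ(j) < σ(j') whenever j, j' ∈ J ∖ J_disc and j ≺ j'. -/
open scoped Classical

noncomputable section

/-- The largest size of a chain consisting of strict predecessors of `j`. -/
def chainHeight {J : Type*} [Fintype J] (prec : J → J → Prop) (j : J) : ℕ :=
  (Finset.univ.filter fun Ch : Finset J =>
    IsChain prec (Ch : Set J) ∧ ∀ i ∈ Ch, prec i j).sup Finset.card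

lemma exists_chain_card_eq_chainHeight {J : Type*} [Fintype J] (prec : J → J → Prop) (j : J) :
    ∃ Ch : Finset J, IsChain prec (Ch : Set J) ∧ (∀ i ∈ Ch, prec i j) ∧
      Ch.card = chainHeight prec j := by
  obtain ⟨Ch, hCh, hcard⟩ := Finset.exists_mem_eq_sup
    (Finset.univ.filter fun Ch : Finset J => IsChain prec (Ch : Set J) ∧ ∀ i ∈ Ch, prec i j)
    ⟨∅, by simp⟩ Finset.card
  rw [Finset.mem_filter] at hCh
  exact ⟨Ch, hCh.2.1, hCh.2.2, hcard.symm⟩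

/-- Adding `j` to a longest chain of strict predecessors of `j`. -/
lemma exists_chain_card_eq_chainHeight_add_one {J : Type*} [Fintype J] {prec : J → J → Prop}
    (hirr : ∀ j, ¬ prec j j) (j : J) :
    ∃ Ch : Finset J, IsChain prec (Ch : Set J) ∧ (∀ i ∈ Ch, i = j ∨ prec i j) ∧
      Ch.card = chainHeight prec j + 1 := by
  obtain ⟨Ch, hCh, hlt, hcard⟩ := exists_chain_card_eq_chainHeight prec j
  refine ⟨insert j Ch, ?_, ?_, ?_⟩
  · rw [Finset.coe_insert]
    exact hCh.insert fun i hi _ => Or.inr (hlt i hi)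
  · intro i hi
    exact (Finset.mem_insert.1 hi).imp_right (hlt i)
  · rw [Finset.card_insert_of_notMem fun hj => hirr j (hlt j hj), hcard]

lemma chainHeight_lt {J : Type*} [Fintype J] {prec : J → J → Prop} (hirr : ∀ j, ¬ prec j j)
    {C : ℕ} (hchain : ∀ Ch : Finset J, IsChain prec (Ch : Set J) → Ch.card ≤ C) (j : J) :
    chainHeight prec j < C := by
  obtain ⟨Ch, hCh, -, hcard⟩ := exists_chain_card_eq_chainHeight_add_one hirr j
  have := hchain Ch hCh
  omega

lemma chainHeight_strictMono {J : Type*} [Fintype J] {prec : J → J → Prop}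
    (hirr : ∀ j, ¬ prec j j)
    (htrans : ∀ j₁ j₂ j₃, prec j₁ j₂ → prec j₂ j₃ → prec j₁ j₃) {j j' : J} (h : prec j j') :
    chainHeight prec j < chainHeight prec j' := by
  obtain ⟨Ch, hCh, hle, hcard⟩ := exists_chain_card_eq_chainHeight_add_one hirr j
  have : Ch.card ≤ chainHeight prec j' := by
    refine Finset.le_sup (f := Finset.card) ?_
    refine Finset.mem_filter.2 ⟨Finset.mem_univ _, hCh, fun i hi => ?_⟩
    rcases hle i hi with rfl | hij
    · exact h
    · exact htrans _ _ _ hij h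
  omega

/-- Swapping the values of `σ` at an inversion increases the weighted sum of its values. -/
lemma sum_mul_lt_sum_mul_comp_swap {J : Type*} [Fintype J] (w σ : J → ℕ) {a b : J}
    (hw : w a < w b) (hσ : σ b < σ a) :
    ∑ i, w i * σ i < ∑ i, w i * σ (Equiv.swap a b i) := by
  have hab : a ≠ b := by rintro rfl; exact hw.false
  have hb : b ∈ Finset.univ.erase a := Finset.mem_erase.2 ⟨hab.symm, Finset.mem_univ _⟩
  have hrest : ∑ i ∈ (Finset.univ.erase a).erase b, w i * σ (Equiv.swap a b i) =
      ∑ i ∈ (Finset.univ.erase a).erase b, w i * σ i := by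
    refine Finset.sum_congr rfl fun i hi => ?_
    rw [Finset.mem_erase, Finset.mem_erase] at hi
    rw [Equiv.swap_apply_of_ne_of_ne hi.2.1 hi.1]
  rw [← Finset.add_sum_erase _ _ (Finset.mem_univ a), ← Finset.add_sum_erase _ _ hb,
    ← Finset.add_sum_erase (a := a) _ (fun i => w i * σ (Equiv.swap a b i)) (Finset.mem_univ a),
    ← Finset.add_sum_erase _ (fun i => w i * σ (Equiv.swap a b i)) hb, hrest]
  simp only [Equiv.swap_apply_left, Equiv.swap_apply_right]
  nlinarith

/-- An assignment respecting windows and capacities can be made weakly monotone with respect to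
a precedence relation that is consistent with the windows. -/
lemma exists_monotone_assignment {J : Type*} [Fintype J] {prec : J → J → Prop} {w : J → ℕ}
    (hw : ∀ {j j'}, prec j j' → w j < w j') {r d : J → ℕ}
    (hconsistent : ∀ j j', prec j j' → r j ≤ r j' ∧ d j ≤ d j') {cap : ℕ → ℕ} {σ₀ : J → ℕ}
    (hσ₀ : ∀ j, r j ≤ σ₀ j ∧ σ₀ j ≤ d j)
    (hcap₀ : ∀ t, (Finset.univ.filter fun j => σ₀ j = t).card ≤ cap t) :
    ∃ σ : J → ℕ, (∀ j, r j ≤ σ j ∧ σ j ≤ d j) ∧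
      (∀ t, (Finset.univ.filter fun j => σ j = t).card ≤ cap t) ∧
      ∀ j j', prec j j' → σ j ≤ σ j' := by
  obtain ⟨σ, ⟨hσ, hcap⟩, hmin⟩ := (measure fun σ : J → ℕ =>
    ∑ i, w i * d i - ∑ i, w i * σ i).wf.has_min
    {σ | (∀ j, r j ≤ σ j ∧ σ j ≤ d j) ∧
      ∀ t, (Finset.univ.filter fun j => σ j = t).card ≤ cap t} ⟨σ₀, hσ₀, hcap₀⟩
  refine ⟨σ, hσ, hcap, fun a b hab => ?_⟩
  by_contra! hlt
  have hwin : ∀ j, r j ≤ σ (Equiv.swap a b j) ∧ σ (Equiv.swap a b j) ≤ d j := by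
    intro j
    have hc := hconsistent a b hab
    have ha := hσ a
    have hb := hσ b
    rw [Equiv.swap_apply_def]
    split_ifs with h₁ h₂
    · subst h₁; omega
    · subst h₂; omega
    · exact hσ j
  have hcap' : ∀ t, (Finset.univ.filter fun j => σ (Equiv.swap a b j) = t).card ≤ cap t := by
    intro t
    refine le_trans (le_of_eq ?_) (hcap t)
    exact Finset.card_equiv (Equiv.swap a b) (by simp)
  have hincr := sum_mul_lt_sum_mul_comp_swap w σ (hw hab) hlt
  have hbound : ∑ i, w i * σ (Equiv.swap a b i) ≤ ∑ i, w i * d i :=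
    Finset.sum_le_sum fun i _ => Nat.mul_le_mul_left _ (hwin i).2
  refine hmin (fun j => σ (Equiv.swap a b j)) ⟨hwin, hcap'⟩ ?_
  change ∑ i, w i * d i - ∑ i, w i * σ (Equiv.swap a b i) < ∑ i, w i * d i - ∑ i, w i * σ i
  omega

/-- A finite set can be ranked compatibly with a given height function. -/
lemma exists_rank {J : Type*} [Fintype J] (S : Finset J) (h : J → ℕ) :
    ∃ q : J → ℕ, Set.InjOn q S ∧ (∀ j ∈ S, q j < S.card) ∧
      ∀ i ∈ S, ∀ j ∈ S, q i ≤ q j → h i ≤ h j := by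
  let key : J → ℕ ×ₗ ℕ := fun j => toLex (h j, (Fintype.equivFin J j : ℕ))
  have key_inj : Function.Injective key := by
    intro i j hij
    have := congrArg (fun x => (ofLex x).2) hij
    simpa [key, Fin.val_inj] using this
  let q : J → ℕ := fun j => (S.filter fun i => key i < key j).card
  have q_lt : ∀ i ∈ S, ∀ j, key i < key j → q i < q j := by
    intro i hi j hij
    refine Finset.card_lt_card (Finset.ssubset_iff_of_subset ?_ |>.2 ⟨i, ?_, ?_⟩)
    · intro l hl
      rw [Finset.mem_filter] at hl ⊢
      exact ⟨hl.1, hl.2.trans hij⟩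
    · simp [hi, hij]
    · simp
  refine ⟨q, fun i hi j hj hij => ?_, fun j hj => ?_, fun i hi j hj hij => ?_⟩
  · rcases lt_trichotomy (key i) (key j) with hlt | heq | hgt
    · exact absurd hij (q_lt i hi j hlt).ne
    · exact key_inj heq
    · exact absurd hij (q_lt j hj i hgt).ne'
  · refine Finset.card_lt_card (Finset.ssubset_iff_of_subset (Finset.filter_subset _ _) |>.2
      ⟨j, hj, by simp⟩)
  · have hle : key i ≤ key j := by
      by_contra! hlt
      exact absurd hij (q_lt j hj i hlt).not_ge
    rcases Prod.Lex.le_iff.1 hle with hlt | heq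
    · exact le_of_lt hlt
    · exact le_of_eq heq.1

/-- Scheduling within a single interval: if the jobs of `S` fit into the total capacity of
`{a + 1, …, a + s}` and have heights below `C`, then discarding at most `m * C` of them allows
scheduling the rest there with heights strictly increasing along time. -/
lemma exists_schedule_Ioc {J : Type*} [Fintype J] (S : Finset J) (h : J → ℕ) {C m a s : ℕ}
    (hC : ∀ j, h j < C) {cap : ℕ → ℕ} (hcap : ∀ t, cap t ≤ m)
    (hS : S.card ≤ ∑ t ∈ Finset.Ioc a (a + s), cap t) :
    ∃ (D : Finset J) (σ : J → ℕ), D.card ≤ m * C ∧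
      (∀ j ∈ S, j ∉ D → a < σ j ∧ σ j ≤ a + s) ∧
      (∀ t, (S.filter fun j => j ∉ D ∧ σ j = t).card ≤ cap t) ∧
      ∀ i ∈ S, ∀ j ∈ S, i ∉ D → j ∉ D → h i < h j → σ i < σ j := by
  obtain ⟨q, q_inj, q_lt, q_mono⟩ := exists_rank S h
  let F : ℕ → ℕ := fun t => ∑ u ∈ Finset.Ioc a t, cap u
  have F_mono : Monotone F := fun t t' htt' =>
    Finset.sum_le_sum_of_subset (Finset.Ioc_subset_Ioc_right htt')
  have F_a : F a = 0 := by simp [F]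
  have F_succ : ∀ t, a ≤ t → F (t + 1) = F t + cap (t + 1) := fun t ht =>
    Finset.sum_Ioc_succ_top ht _
  let x : J → ℕ := fun j => q j + m * h j
  have x_inj : Set.InjOn x S := by
    intro i hi j hj hij
    rcases le_total (q i) (q j) with hq | hq
    · have := Nat.mul_le_mul_left m (q_mono i hi j hj hq)
      exact q_inj hi hj (by simp only [x] at hij; omega)
    · have := Nat.mul_le_mul_left m (q_mono j hj i hi hq)
      exact q_inj hi hj (by simp only [x] at hij; omega)
  let σ : J → ℕ := fun j => sInf {t | x j < F t}
  let D : Finset J := S.filter fun j => F (a + s) ≤ x j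
  have hσ : ∀ j ∈ S, j ∉ D →
      a < σ j ∧ σ j ≤ a + s ∧ F (σ j - 1) ≤ x j ∧ x j < F (σ j) ∧
        F (σ j) = F (σ j - 1) + cap (σ j) := by
    intro j hj hjD
    have hlt : x j < F (a + s) := by
      by_contra! hle
      exact hjD (Finset.mem_filter.2 ⟨hj, hle⟩)
    have hmem : x j < F (σ j) := Nat.sInf_mem (s := {t | x j < F t}) ⟨a + s, hlt⟩
    have ha : a < σ j := by
      by_contra! hle
      have := F_mono hle
      omega
    refine ⟨ha, Nat.sInf_le hlt, ?_, hmem, ?_⟩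
    · have : σ j - 1 ∉ {t | x j < F t} := Nat.notMem_of_lt_sInf (show σ j - 1 < σ j by omega)
      simpa using this
    · have := F_succ (σ j - 1) (by omega)
      rwa [Nat.sub_add_cancel (by omega)] at this
  refine ⟨D, σ, ?_, fun j hj hjD => ⟨(hσ j hj hjD).1, (hσ j hj hjD).2.1⟩, fun t => ?_, ?_⟩
  · have hsub : ∀ j ∈ D, q j ∈ Finset.Ico (S.card - m * C) S.card := by
      intro j hj
      obtain ⟨hjS, hle⟩ := Finset.mem_filter.1 hj
      have h₁ : m * h j ≤ m * C := Nat.mul_le_mul_left _ (hC j).le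
      have h₂ : S.card ≤ q j + m * h j := hS.trans hle
      exact Finset.mem_Ico.2 ⟨by omega, q_lt j hjS⟩
    have := Finset.card_le_card_of_injOn q hsub
      (q_inj.mono (Finset.coe_subset.2 (Finset.filter_subset _ _)))
    rw [Nat.card_Ico] at this
    omega
  · rcases (S.filter fun j => j ∉ D ∧ σ j = t).eq_empty_or_nonempty with hempty | ⟨j₀, hj₀⟩
    · simp [hempty]
    have hsub : ∀ j ∈ S.filter (fun j => j ∉ D ∧ σ j = t),
        x j ∈ Finset.Ico (F (t - 1)) (F t) := by
      intro j hj
      obtain ⟨hjS, hjD, rfl⟩ := Finset.mem_filter.1 hj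
      have := hσ j hjS hjD
      exact Finset.mem_Ico.2 ⟨this.2.2.1, this.2.2.2.1⟩
    have hcard := Finset.card_le_card_of_injOn x hsub
      (x_inj.mono (Finset.coe_subset.2 (Finset.filter_subset _ _)))
    obtain ⟨hjS, hjD, rfl⟩ := Finset.mem_filter.1 hj₀
    have := (hσ j₀ hjS hjD).2.2.2.2
    rw [Nat.card_Ico] at hcard
    omega
  · intro i hi j hj hiD hjD hij
    by_contra! hle
    have hF := F_mono hle
    obtain ⟨-, -, hi₁, -, hi₂⟩ := hσ i hi hiD
    obtain ⟨-, -, -, hj₁, -⟩ := hσ j hj hjD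
    have hq : q i < q j := by
      by_contra! hqle
      exact absurd (q_mono j hj i hi hqle) (by omega)
    have hm : m * (h i + 1) ≤ m * h j := Nat.mul_le_mul_left _ hij
    have := hcap (σ i)
    simp only [x, Nat.mul_add, mul_one] at *
    omega

/-- The EDF theorem: unit jobs with release times `r_j`, deadlines `d_j` (consistent with a
strict precedence order `≺` whose chains have at most `C` elements), where `{1,…,T}` is split
into `p` equal intervals of length `s`, each `r_j` is the first and each `d_j` the last unit of
some interval. If there is a capacity-respecting assignment of all jobs within their
release-deadline windows (ignoring precedence within `J`), then one can schedule all but at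
most `p·m·C` jobs within their windows, respecting the capacities and all precedence
constraints. -/
theorem statement11 (J : Type) [Fintype J] (prec : J → J → Prop)
    (hirr : ∀ j, ¬ prec j j)
    (htrans : ∀ j₁ j₂ j₃, prec j₁ j₂ → prec j₂ j₃ → prec j₁ j₃)
    (T p s m C : ℕ) (hp : 0 < p) (hs : 0 < s) (hT : T = p * s)
    (r d : J → ℕ)
    (hrd : ∀ j, 1 ≤ r j ∧ r j ≤ d j ∧ d j ≤ T)
    (hconsistent : ∀ j j', prec j j' → r j ≤ r j' ∧ d j ≤ d j')
    (hchain : ∀ Ch : Finset J, IsChain prec (Ch : Set J) → Ch.card ≤ C)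
    (hrel : ∀ j, ∃ i : ℕ, 1 ≤ i ∧ i ≤ p ∧ r j = (i - 1) * s + 1)
    (hdl : ∀ j, ∃ i : ℕ, 1 ≤ i ∧ i ≤ p ∧ d j = i * s)
    (cap : ℕ → ℕ) (hcap : ∀ t, cap t ≤ m)
    (σt : J → ℕ)
    (hσt : ∀ j, r j ≤ σt j ∧ σt j ≤ d j)
    (hσtcap : ∀ t : ℕ, (Finset.univ.filter (fun j => σt j = t)).card ≤ cap t) :
    ∃ (Jdisc : Finset J) (σ : J → ℕ),
      Jdisc.card ≤ p * m * C ∧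
      (∀ j ∉ Jdisc, r j ≤ σ j ∧ σ j ≤ d j) ∧
      (∀ t : ℕ, (Finset.univ.filter (fun j => j ∉ Jdisc ∧ σ j = t)).card ≤ cap t) ∧
      (∀ j j', j ∉ Jdisc → j' ∉ Jdisc → prec j j' → σ j < σ j') := by
  obtain ⟨τ, hτ, hτcap, hτmono⟩ := exists_monotone_assignment
    (fun hjj' => chainHeight_strictMono hirr htrans hjj') hconsistent hσt hσtcap
  let k : J → ℕ := fun j => (τ j - 1) / s
  have k_le : ∀ j, k j * s < τ j ∧ τ j ≤ (k j + 1) * s := by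
    intro j
    have h₁ := Nat.div_mul_le_self (τ j - 1) s
    have h₂ := Nat.lt_mul_of_div_lt (Nat.lt_succ_self ((τ j - 1) / s)) hs
    have h₃ := (hrd j).1
    have h₄ := (hτ j).1
    simp only [k]
    simp only [Nat.succ_eq_add_one] at h₂
    omega
  have k_lt : ∀ j, k j < p := by
    intro j
    have : k j * s < p * s := by
      have := k_le j
      have := hτ j
      have := hrd j
      omega
    exact lt_of_mul_lt_mul_right this (Nat.zero_le s)
  have r_le : ∀ j, r j ≤ k j * s + 1 := by
    intro j
    obtain ⟨i, -, -, hi⟩ := hrel j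
    have : (i - 1) * s < (k j + 1) * s := by
      have := k_le j
      have := hτ j
      omega
    have := Nat.mul_le_mul_right s (Nat.le_of_lt_succ (lt_of_mul_lt_mul_right this (Nat.zero_le s)))
    omega
  have le_d : ∀ j, (k j + 1) * s ≤ d j := by
    intro j
    obtain ⟨i, -, -, hi⟩ := hdl j
    have : k j * s < i * s := by
      have := k_le j
      have := hτ j
      omega
    rw [hi]
    exact Nat.mul_le_mul_right s (lt_of_mul_lt_mul_right this (Nat.zero_le s))
  have hfit : ∀ l, (Finset.univ.filter fun j => k j = l).card ≤
      ∑ t ∈ Finset.Ioc (l * s) (l * s + s), cap t := by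
    intro l
    rw [Finset.card_eq_sum_card_fiberwise (f := τ) (t := Finset.Ioc (l * s) (l * s + s))]
    · refine Finset.sum_le_sum fun t _ => le_trans (Finset.card_le_card ?_) (hτcap t)
      exact Finset.filter_subset_filter _ (Finset.subset_univ _)
    · intro j hj
      obtain rfl : k j = l := by simpa using hj
      have := k_le j
      rw [add_one_mul] at this
      simpa using this
  choose D ρ hD hρwin hρcap hρmono using fun l => exists_schedule_Ioc
    (Finset.univ.filter fun j => k j = l) (chainHeight prec) (chainHeight_lt hirr hchain) hcap
    (hfit l)
  have hρ : ∀ j, j ∉ (Finset.range p).biUnion D →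
      j ∉ D (k j) ∧ k j * s < ρ (k j) j ∧ ρ (k j) j ≤ (k j + 1) * s := by
    intro j hj
    have hjD : j ∉ D (k j) := fun hmem =>
      hj (Finset.mem_biUnion.2 ⟨k j, Finset.mem_range.2 (k_lt j), hmem⟩)
    rw [add_one_mul]
    exact ⟨hjD, hρwin (k j) j (by simp) hjD⟩
  refine ⟨(Finset.range p).biUnion D, fun j => ρ (k j) j, ?_, fun j hj => ?_, fun t => ?_,
    fun j j' hj hj' hjj' => ?_⟩
  · rw [mul_assoc]
    simpa using Finset.card_biUnion_le_card_mul (Finset.range p) D (m * C) fun l _ => hD l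
  · have := hρ j hj
    have := r_le j
    have := le_d j
    dsimp only
    omega
  · refine le_trans (Finset.card_le_card fun j hj => ?_) (hρcap ((t - 1) / s) t)
    obtain ⟨-, hj_kept, rfl⟩ := Finset.mem_filter.1 hj
    obtain ⟨hjD, hlt, hle⟩ := hρ j hj_kept
    dsimp only
    have hk : (ρ (k j) j - 1) / s = k j :=
      Nat.div_eq_of_lt_le (by omega) (by omega)
    rw [hk]
    simp [hjD]
  · obtain ⟨hjD, -, hle⟩ := hρ j hj
    obtain ⟨hjD', hlt, -⟩ := hρ j' hj'
    have hk : k j ≤ k j' := Nat.div_le_div_right (Nat.sub_le_sub_right (hτmono j j' hjj') 1)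
    rcases hk.lt_or_eq with hk | hk
    · exact hle.trans_lt ((Nat.mul_le_mul_right s hk).trans_lt hlt)
    · have := hρmono (k j) j (by simp) j' (by simp [hk]) hjD (hk ▸ hjD')
        (chainHeight_strictMono hirr htrans hjj')
      dsimp only
      rwa [← hk]

end
end

section
/- Let q ∈ ℕ with q ≥ 1, let N ∈ ℕ, and let α_0, α_1, …, α_N be real numbers satisfying α_i ≥ α_min > 0 and α_i ≥ (1/q)·∑_{j=1}^{i} α_j for all i ∈ {0,…,N}. Then α_i ≥ 2^{⌊i/(2q)⌋}·α_min for every i ∈ {0,…,N}. -/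
noncomputable section

/-- If `α_i ≥ α_min > 0` and `α_i ≥ (1/q)·∑_{j=1}^{i} α_j` for all `i ∈ {0,…,N}`, then
`α_i ≥ 2^{⌊i/(2q)⌋}·α_min` for every `i ∈ {0,…,N}`. -/
theorem statement12 (q : ℕ) (hq : 1 ≤ q) (N : ℕ) (α : ℕ → ℝ) (αmin : ℝ)
    (hαmin : 0 < αmin)
    (hlb : ∀ i ≤ N, αmin ≤ α i)
    (hrec : ∀ i ≤ N, (1 / (q : ℝ)) * ∑ j ∈ Finset.Icc 1 i, α j ≤ α i) :
    ∀ i ≤ N, (2 : ℝ) ^ (i / (2 * q)) * αmin ≤ α i := by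
  suffices key : ∀ k i, i ≤ N → k * (2 * q) ≤ i → (2 : ℝ) ^ k * αmin ≤ α i from
    fun i hi => key _ i hi (Nat.div_mul_le_self i (2 * q))
  intro k
  induction k with
  | zero => intro i hi _; simpa using hlb i hi
  | succ k ih =>
    intro i hi hki
    rw [Nat.succ_mul] at hki
    have hq0 : (0 : ℝ) < q := by exact_mod_cast hq
    have hsub : Finset.Ioc (i - 2 * q) i ⊆ Finset.Icc 1 i := by
      intro j hj
      rw [Finset.mem_Ioc] at hj
      rw [Finset.mem_Icc]
      omega
    have hcard : (Finset.Ioc (i - 2 * q) i).card = 2 * q := by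
      rw [Nat.card_Ioc]
      omega
    have hblock : (2 * q : ℝ) * (2 ^ k * αmin) ≤ ∑ j ∈ Finset.Ioc (i - 2 * q) i, α j := by
      have h := Finset.card_nsmul_le_sum (Finset.Ioc (i - 2 * q) i) α (2 ^ k * αmin) <| by
        intro j hj
        rw [Finset.mem_Ioc] at hj
        exact ih j (by omega) (by omega)
      rw [hcard, nsmul_eq_mul] at h
      exact_mod_cast h
    have hsum : ∑ j ∈ Finset.Ioc (i - 2 * q) i, α j ≤ ∑ j ∈ Finset.Icc 1 i, α j :=
      Finset.sum_le_sum_of_subset_of_nonneg hsub fun j hj _ =>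
        hαmin.le.trans (hlb j ((Finset.mem_Icc.mp hj).2.trans hi))
    calc (2 : ℝ) ^ (k + 1) * αmin = 1 / q * (2 * q * (2 ^ k * αmin)) := by
          field_simp
          ring
      _ ≤ 1 / q * ∑ j ∈ Finset.Icc 1 i, α j := by
          gcongr
          exact hblock.trans hsum
      _ ≤ α i := hrec i hi

end
end

section
/- Let q ∈ ℕ with q ≥ 1, let α_min > 0 and M > 0 be reals, and let α_0, α_1, …, α_N be nonnegative reals with ∑_{i=0}^{N} α_i ≤ M. If 2^{⌊N/(2q)⌋}·α_min > M, then there exists an index i ∈ {0,…,N} such that α_i ≤ α_min or α_i ≤ (1/q)·∑_{j=1}^{i} α_j. -/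
noncomputable section

/-- If every term exceeds `1 / q` times the partial sum up to it, then the partial sums grow at
least linearly from any starting index. -/
lemma partialSum_linear_growth {q N : ℕ} (hq : 1 ≤ q) {α : ℕ → ℝ}
    (hnonneg : ∀ i ≤ N, 0 ≤ α i)
    (hα : ∀ i ≤ N, 1 / (q : ℝ) * ∑ j ∈ Finset.Icc 1 i, α j < α i) (i m : ℕ) (him : i + m ≤ N) :
    (1 + m / (q : ℝ)) * ∑ j ∈ Finset.Icc 1 i, α j ≤ ∑ j ∈ Finset.Icc 1 (i + m), α j := by
  induction m with
  | zero => simp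
  | succ m ih =>
    have hq0 : 0 < (q : ℝ) := by exact_mod_cast hq
    have hmono : ∑ j ∈ Finset.Icc 1 i, α j ≤ ∑ j ∈ Finset.Icc 1 (i + (m + 1)), α j := by
      refine Finset.sum_le_sum_of_subset_of_nonneg
        (Finset.Icc_subset_Icc_right (by omega)) fun j hj _ => hnonneg j ?_
      exact (Finset.mem_Icc.mp hj).2.trans him
    have hterm : 1 / (q : ℝ) * ∑ j ∈ Finset.Icc 1 i, α j ≤ α (i + (m + 1)) :=
      (mul_le_mul_of_nonneg_left hmono (by positivity)).trans (hα _ him).le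
    have hsplit : ∑ j ∈ Finset.Icc 1 (i + (m + 1)), α j
        = ∑ j ∈ Finset.Icc 1 (i + m), α j + α (i + (m + 1)) :=
      Finset.sum_Icc_succ_top (by omega) α
    have hih := ih (by omega)
    have hcoef : (1 + ((m + 1 : ℕ) : ℝ) / q) * ∑ j ∈ Finset.Icc 1 i, α j
        = (1 + m / (q : ℝ)) * ∑ j ∈ Finset.Icc 1 i, α j
          + 1 / (q : ℝ) * ∑ j ∈ Finset.Icc 1 i, α j := by
      push_cast
      ring
    linarith

/-- If every term exceeds `1 / q` times the partial sum up to it, then the partial sums at least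
double every `q` steps. -/
lemma partialSum_geometric_growth {q N : ℕ} (hq : 1 ≤ q) {α : ℕ → ℝ}
    (hnonneg : ∀ i ≤ N, 0 ≤ α i)
    (hα : ∀ i ≤ N, 1 / (q : ℝ) * ∑ j ∈ Finset.Icc 1 i, α j < α i) (k : ℕ)
    (hk : 1 + q * k ≤ N) :
    2 ^ k * α 1 ≤ ∑ j ∈ Finset.Icc 1 (1 + q * k), α j := by
  induction k with
  | zero => simp
  | succ k ih =>
    have hq0 : (q : ℝ) ≠ 0 := by exact_mod_cast (by omega : q ≠ 0)
    have hidx : 1 + q * (k + 1) = 1 + q * k + q := by ring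
    rw [hidx] at hk ⊢
    have hstep := partialSum_linear_growth hq hnonneg hα (1 + q * k) q hk
    rw [div_self hq0] at hstep
    have hih := ih (by omega)
    rw [pow_succ]
    linarith

/-- Contrapositive form used to select the splitting level: if `α_0,…,α_N` are nonnegative
with total sum at most `M`, and `2^{⌊N/(2q)⌋}·α_min > M`, then some index `i ≤ N` satisfies
`α_i ≤ α_min` or `α_i ≤ (1/q)·∑_{j=1}^{i} α_j`. -/
theorem statement13 (q : ℕ) (hq : 1 ≤ q) (N : ℕ) (α : ℕ → ℝ) (αmin M : ℝ)
    (hαmin : 0 < αmin) (hM : 0 < M)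
    (hnonneg : ∀ i ≤ N, 0 ≤ α i)
    (hsum : ∑ i ∈ Finset.range (N + 1), α i ≤ M)
    (hbig : M < (2 : ℝ) ^ (N / (2 * q)) * αmin) :
    ∃ i ≤ N, α i ≤ αmin ∨ α i ≤ (1 / (q : ℝ)) * ∑ j ∈ Finset.Icc 1 i, α j := by
  by_contra! h
  have hmin : ∀ i ≤ N, αmin < α i := fun i hi => (h i hi).1
  have hα : ∀ i ≤ N, 1 / (q : ℝ) * ∑ j ∈ Finset.Icc 1 i, α j < α i := fun i hi => (h i hi).2
  have hle : ∀ s ⊆ Finset.range (N + 1), ∑ j ∈ s, α j ≤ M := fun s hs =>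
    (Finset.sum_le_sum_of_subset_of_nonneg hs fun j hj _ =>
      hnonneg j (Nat.lt_succ_iff.mp (Finset.mem_range.mp hj))).trans hsum
  rcases Nat.eq_zero_or_pos (N / (2 * q)) with hk | hk
  · have h0 := hle {0} (by simp)
    rw [Finset.sum_singleton] at h0
    rw [hk, pow_zero, one_mul] at hbig
    linarith [hmin 0 (Nat.zero_le N)]
  · set k := N / (2 * q)
    have hkN : 2 * q * k ≤ N := Nat.mul_div_le N (2 * q)
    have hqk : 1 ≤ q * k := Nat.mul_pos hq hk
    have hidx : 1 + q * k ≤ N := by nlinarith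
    have hgrow := partialSum_geometric_growth hq hnonneg hα k hidx
    have hbound := hle (Finset.Icc 1 (1 + q * k)) fun j hj => by
      rw [Finset.mem_Icc] at hj
      rw [Finset.mem_range]
      omega
    have hfirst : (2 : ℝ) ^ k * αmin ≤ 2 ^ k * α 1 :=
      mul_le_mul_of_nonneg_left (hmin 1 (by omega)).le (by positivity)
    linarith

end
end

section
/- Let m ≥ 1 and k ≥ 1 be integers. Consider the instance with job set J = J_1 ∪ … ∪ J_k, where the J_i are pairwise disjoint with |J_i| = m + 1, and precedence order j ≺ j' if and only if j ∈ J_i and j' ∈ J_{i'} with i < i'. Then every feasible schedule σ : J → {1,…,T} on m identical machines (|σ^{-1}(t)| ≤ m for all t, and σ(j) < σ(j') whenever j ≺ j') satisfies max_{j∈J} σ(j) ≥ 2k; i.e., the optimal makespan of this instance is at least 2k. -/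
open scoped Classical

noncomputable section

/-- If every value of `σ` is attained at most `m` times, then `σ` is not constant on a finite set
with more than `m` elements. -/
theorem exists_lt_of_fiber_card_le {J : Type*} [Fintype J] {m : ℕ} {σ : J → ℕ}
    (hcap : ∀ t : ℕ, (Finset.univ.filter (fun j => σ j = t)).card ≤ m)
    {s : Finset J} (hs : m < s.card) : ∃ a ∈ s, ∃ b ∈ s, σ a < σ b := by
  by_contra! h
  obtain ⟨a, ha⟩ : s.Nonempty := Finset.card_pos.mp (by omega)
  have hsub : s ⊆ Finset.univ.filter (fun j => σ j = σ a) := fun b hb =>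
    Finset.mem_filter.mpr ⟨Finset.mem_univ b, le_antisymm (h a ha b hb) (h b hb a ha)⟩
  have := Finset.card_le_card hsub
  have := hcap (σ a)
  omega

/-- The block instance: jobs are partitioned into `k` blocks of `m+1` jobs each (`blk j` is the
block of `j`), and `j ≺ j'` iff the block of `j` comes strictly before the block of `j'`.
Every feasible schedule on `m` identical machines has makespan at least `2k`. -/
theorem statement14 (m k : ℕ) (hm : 1 ≤ m) (hk : 1 ≤ k)
    (J : Type) [Fintype J] (blk : J → Fin k)
    (hblk : ∀ i : Fin k, (Finset.univ.filter (fun j => blk j = i)).card = m + 1)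
    (T : ℕ) (σ : J → ℕ)
    (hlo : ∀ j, 1 ≤ σ j) (hhi : ∀ j, σ j ≤ T)
    (hcap : ∀ t : ℕ, (Finset.univ.filter (fun j => σ j = t)).card ≤ m)
    (hprec : ∀ j j', blk j < blk j' → σ j < σ j') :
    ∃ j : J, 2 * k ≤ σ j := by
  have two_slots (i : Fin k) : ∃ a b, blk a = i ∧ blk b = i ∧ σ a < σ b := by
    obtain ⟨a, ha, b, hb, hab⟩ := exists_lt_of_fiber_card_le hcap
      (s := Finset.univ.filter (fun j => blk j = i)) (by rw [hblk]; omega)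
    exact ⟨a, b, (Finset.mem_filter.mp ha).2, (Finset.mem_filter.mp hb).2, hab⟩
  have late (n : ℕ) (hn : n < k) : ∃ j, blk j = ⟨n, hn⟩ ∧ 2 * (n + 1) ≤ σ j := by
    induction n with
    | zero =>
      obtain ⟨a, b, -, hb, hab⟩ := two_slots ⟨0, hn⟩
      have := hlo a
      exact ⟨b, hb, by omega⟩
    | succ n ih =>
      obtain ⟨c, hc, hσc⟩ := ih (by omega)
      obtain ⟨a, b, ha, hb, hab⟩ := two_slots ⟨n + 1, hn⟩
      have := hprec c a (by simp [hc, ha])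
      exact ⟨b, hb, by omega⟩
  obtain ⟨j, -, hj⟩ := late (k - 1) (by omega)
  exact ⟨j, by omega⟩

end
end

section
/- Let m ≥ 1 and k ≥ 1 be integers and consider the instance with job set J = J_1 ∪ … ∪ J_k, where the J_i are pairwise disjoint with |J_i| = m + 1, and precedence order j ≺ j' if and only if j ∈ J_i and j' ∈ J_{i'} with i < i'. Then the time-indexed LP polytope K(T) of this instance is nonempty for T = ⌈k·(m+1)/m⌉. Combined with the integral makespan lower bound of 2k for this instance, this shows that the integrality gap of the time-indexed LP is at least 2k/⌈k(m+1)/m⌉, which tends to 2 − 2/(m+1) as k → ∞. -/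
open scoped Classical

noncomputable section

namespace SchedLP

/-- The time-indexed LP polytope `K(T)`. -/
def KSched (J : Type) [Fintype J] (prec : J → J → Prop) (m T : ℕ) :
    Set (SchedVar J T → ℝ) :=
  KPoly (schedA prec T) (schedb J m T)

/-- A family `f` of assignment values satisfying the constraints of the time-indexed LP extends
to a point of `K(T)`. -/
theorem KSched_nonempty_of_assignment {J : Type} [Fintype J] (prec : J → J → Prop) (m T : ℕ)
    (f : J → Fin T → ℝ) (h_sum : ∀ j, ∑ t, f j t = 1) (h_cap : ∀ t, ∑ j, f j t ≤ m)
    (h_prec : ∀ i j (t : Fin T), prec i j →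
      ∑ t' : Fin T, (if (t' : ℕ) < t + 2 then f j t' else 0) ≤
        ∑ t' : Fin T, if (t' : ℕ) < t + 1 then f i t' else 0)
    (h_nonneg : ∀ j t, 0 ≤ f j t) (h_le_one : ∀ j t, f j t ≤ 1) :
    (KSched J prec m T).Nonempty := by
  refine ⟨fun v => match v with
    | Sum.inl (j, t) => f j t
    | Sum.inr (j, I) => ∑ t, if memIv t I then f j t else 0, ?_⟩
  rintro ((j | j) | t | ⟨i, j, t⟩ | (⟨j, I⟩ | ⟨j, I⟩) | (⟨j, t⟩ | ⟨j, t⟩))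
  · simp [schedA, schedb, Fintype.sum_prod_type_right, h_sum]
  · simp [schedA, schedb, Fintype.sum_prod_type_right, h_sum]
  · simpa [schedA, schedb, Fintype.sum_prod_type] using h_cap t
  · by_cases hp : prec i j
    · have h := h_prec i j t hp
      simp only [Nat.lt_succ_iff, ← sub_nonneg (b := Finset.sum _ _), ← Finset.sum_sub_distrib] at h
      refine h.trans_eq ?_
      simp [schedA, Fintype.sum_prod_type_right, hp, add_mul, ite_and, Finset.sum_add_distrib,
        sub_eq_add_neg, neg_ite]
    · simp [schedA, schedb, hp]
  · have h_neg (t : Fin T) : (if memIv t I then -f j t else 0) = -if memIv t I then f j t else 0 := by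
      split_ifs <;> simp
    simp [schedA, schedb, Fintype.sum_prod_type_right, ite_and, h_neg]
  · simp [schedA, schedb, Fintype.sum_prod_type_right, ite_and]
  · simpa [schedA, schedb] using h_nonneg j t
  · simpa [schedA, schedb] using h_le_one j t

theorem sum_fin_ite_sub (g : ℕ → ℝ) (n T : ℕ) :
    ∑ t : Fin T, (if (t : ℕ) < n then g (t + 1) - g t else 0) = g (min n T) - g 0 := by
  induction T with
  | zero => simp
  | succ T ih =>
    rw [Fin.sum_univ_castSucc]
    simp only [Fin.val_castSucc, Fin.val_last, ih]
    split_ifs with h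
    · rw [min_eq_right h.le, min_eq_right h]; ring
    · rw [min_eq_left (by omega), min_eq_left (by omega)]; ring

/-- The fraction of block `i` processed once `u` blocks have been processed in total. -/
def blockProgress (u : ℝ) (i : ℕ) : ℝ := max 0 (min 1 (u - i))

theorem blockProgress_nonneg (u : ℝ) (i : ℕ) : 0 ≤ blockProgress u i := le_max_left _ _

theorem blockProgress_le_one (u : ℝ) (i : ℕ) : blockProgress u i ≤ 1 :=
  max_le zero_le_one (min_le_left _ _)

theorem blockProgress_le {u v : ℝ} {i j : ℕ} (h : u - i ≤ v - j) :
    blockProgress u i ≤ blockProgress v j :=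
  max_le_max le_rfl (min_le_min le_rfl h)

theorem blockProgress_zero (i : ℕ) : blockProgress 0 i = 0 :=
  max_eq_left ((min_le_right _ _).trans (by simp))

theorem blockProgress_eq_one {u : ℝ} {i : ℕ} (h : (i : ℝ) + 1 ≤ u) : blockProgress u i = 1 := by
  rw [blockProgress, min_eq_left (by linarith), max_eq_right zero_le_one]

theorem sum_blockProgress {u : ℝ} (hu : 0 ≤ u) (k : ℕ) :
    ∑ i : Fin k, blockProgress u i = min u k := by
  induction k with
  | zero => simp [hu]
  | succ k ih =>
    rw [Fin.sum_univ_castSucc]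
    simp only [Fin.val_castSucc, Fin.val_last, ih]
    rw [blockProgress]
    push_cast
    grind

theorem sum_blockProgress_sub_le {u v : ℝ} (hu : 0 ≤ u) (huv : u ≤ v) (k : ℕ) :
    ∑ i : Fin k, (blockProgress v i - blockProgress u i) ≤ v - u := by
  rw [Finset.sum_sub_distrib, sum_blockProgress hu, sum_blockProgress (hu.trans huv)]
  grind

theorem KSched_blocks_nonempty (m k T : ℕ) (hm : 1 ≤ m) (hT : (k : ℝ) * (m + 1) / m ≤ T) :
    (KSched (Fin k × Fin (m + 1)) (fun p q => p.1 < q.1) m T).Nonempty := by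
  have hm' : (1 : ℝ) ≤ m := by exact_mod_cast hm
  set r : ℝ := m / (m + 1) with hr
  have hr0 : 0 ≤ r := by positivity
  have hr1 : r ≤ 1 := by rw [hr, div_le_one (by positivity)]; linarith
  have hkT : (k : ℝ) ≤ T * r := by
    rw [div_le_iff₀ (by positivity)] at hT
    rwa [hr, ← mul_div_assoc, le_div_iff₀ (by positivity)]
  have h_zero (i : ℕ) : blockProgress ((0 : ℕ) * r) i = 0 := by simp [blockProgress_zero]
  have h_mono (t : ℕ) : (t : ℝ) * r ≤ (t + 1 : ℕ) * r := by
    push_cast; linarith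
  refine KSched_nonempty_of_assignment _ m T
    (fun p t => blockProgress ((t + 1 : ℕ) * r) p.1 - blockProgress ((t : ℕ) * r) p.1)
    ?_ ?_ ?_ ?_ ?_
  · rintro ⟨i, a⟩
    have h := sum_fin_ite_sub (fun s => blockProgress (s * r) i) T T
    simp only [Fin.is_lt, if_true, min_self, h_zero] at h
    rw [h, sub_zero, blockProgress_eq_one]
    have : (i : ℝ) + 1 ≤ k := by exact_mod_cast i.is_lt
    linarith
  · intro t
    rw [Fintype.sum_prod_type_right]
    simp only [Finset.sum_const, Finset.card_univ, Fintype.card_fin, nsmul_eq_mul]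
    have h := sum_blockProgress_sub_le (by positivity) (h_mono t) k
    calc _ ≤ ((m + 1 : ℕ) : ℝ) * ((t + 1 : ℕ) * r - (t : ℕ) * r) := by gcongr
      _ = m := by push_cast; rw [hr]; field_simp; ring
  · rintro ⟨i, a⟩ ⟨j, b⟩ t hij
    have hi := sum_fin_ite_sub (fun s => blockProgress (s * r) i) (t + 1) T
    have hj := sum_fin_ite_sub (fun s => blockProgress (s * r) j) (t + 2) T
    simp only [h_zero, sub_zero, min_eq_left (Nat.succ_le_of_lt t.is_lt)] at hi hj
    rw [hi, hj]
    apply blockProgress_le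
    have hij' : (i : ℝ) + 1 ≤ j := by exact_mod_cast hij
    have hmin : ((min (t + 2 : ℕ) T : ℕ) : ℝ) ≤ t + 2 := by exact_mod_cast min_le_left _ _
    have := mul_le_mul_of_nonneg_right hmin hr0
    push_cast at *
    linarith
  · rintro ⟨i, a⟩ t
    exact sub_nonneg.2 (blockProgress_le (sub_le_sub_right (h_mono t) _))
  · rintro ⟨i, a⟩ t
    linarith [blockProgress_le_one ((t + 1 : ℕ) * r) i, blockProgress_nonneg ((t : ℕ) * r) i]

theorem tendsto_two_mul_div_ceil (m : ℕ) (hm : 1 ≤ m) :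
    Filter.Tendsto (fun k : ℕ => (2 * k : ℝ) / (⌈((k : ℝ) * (m + 1)) / m⌉₊ : ℝ))
      Filter.atTop (nhds (2 - 2 / ((m : ℝ) + 1))) := by
  have hm' : (0 : ℝ) < m := by exact_mod_cast hm
  have h := (((tendsto_nat_ceil_mul_div_atTop
    (by positivity : (0 : ℝ) ≤ (m + 1) / m)).comp
      tendsto_natCast_atTop_atTop).inv₀ (by positivity)).const_mul 2
  convert h using 2 with k
  · simp only [Function.comp_apply, inv_div, mul_div_assoc, mul_comm (k : ℝ), div_mul_eq_mul_div]
  · field_simp; ring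

/-- For the block instance (jobs `Fin k × Fin (m+1)`, block `i` before block `i'` iff `i < i'`),
the time-indexed LP polytope `K(T)` is nonempty for `T = ⌈k(m+1)/m⌉`; moreover the resulting
gap ratio `2k/⌈k(m+1)/m⌉` tends to `2 − 2/(m+1)` as `k → ∞`. -/
theorem statement15 (m : ℕ) (hm : 1 ≤ m) :
    (∀ k : ℕ, 1 ≤ k →
      (KSched (Fin k × Fin (m + 1)) (fun p q => p.1 < q.1) m
        ⌈((k : ℝ) * (m + 1)) / m⌉₊).Nonempty) ∧
    Filter.Tendsto (fun k : ℕ => (2 * k : ℝ) / (⌈((k : ℝ) * (m + 1)) / m⌉₊ : ℝ))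
      Filter.atTop (nhds (2 - 2 / ((m : ℝ) + 1))) := by
  exact ⟨fun k _ => KSched_blocks_nonempty m k _ hm (Nat.le_ceil _),
    tendsto_two_mul_div_ceil m hm⟩

end SchedLP

end
end
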